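/- arXiv:1711.02726 — 2 statements merged into one kernel-verified Lean document; each statement's English description precedes it below -/
import Mathlib

section
/- Let ν₁, …, νₙ be positive real numbers that are linearly independent over ℚ, and let d = (d₁,…,dₙ) and e = (e₁,…,eₙ) be vectors of natural numbers such that Σᵢ dᵢνᵢ < Σᵢ eᵢνᵢ. Then there exists an n×n matrix A = (a_{ij}) with entries in ℕ and determinant 1 such that: (i) the unique real solution ν' = (ν₁',…,νₙ') of the linear system νᵢ = Σⱼ a_{ij} νⱼ' (i.e., ν' = A⁻¹ν) has all entries positive, and (ii) Σᵢ dᵢ a_{ij} ≤ Σᵢ eᵢ a_{ij} for every j with 1 ≤ j ≤ n. (Equivalently: after the Perron (monomial) substitution xᵢ = Πⱼ xⱼ(1)^{a_{ij}} with new variables xⱼ(1) of positive value νⱼ', the monomial M₁ = x₁^{d₁}⋯xₙ^{dₙ} divides M₂ = x₁^{e₁}⋯xₙ^{eₙ} in the polynomial ring in the new variables.) -/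
/-- One elementary step: if the conclusion holds after `ν a ↦ ν a - ν b`, `c b ↦ c b + c a`,
then it holds before. -/
lemma perron_step {n : ℕ} (ν : Fin n → ℝ) (c : Fin n → ℤ) (a b : Fin n) (hab : a ≠ b)
    (h : ∃ A : Matrix (Fin n) (Fin n) ℕ,
      (A.map (Nat.cast : ℕ → ℤ)).det = 1 ∧
      ∃ ν' : Fin n → ℝ,
        (∀ i, (ν i - if i = a then ν b else 0) = ∑ j, (A i j : ℝ) * ν' j) ∧
        (∀ j, 0 < ν' j) ∧
        (∀ j : Fin n, 0 ≤ ∑ i, (c i + if i = b then c a else 0) * (A i j : ℤ))) :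
    ∃ A : Matrix (Fin n) (Fin n) ℕ,
      (A.map (Nat.cast : ℕ → ℤ)).det = 1 ∧
      ∃ ν' : Fin n → ℝ,
        (∀ i, ν i = ∑ j, (A i j : ℝ) * ν' j) ∧
        (∀ j, 0 < ν' j) ∧
        (∀ j : Fin n, 0 ≤ ∑ i, c i * (A i j : ℤ)) := by
  obtain ⟨A, hA, ν', h1, h2, h3⟩ := h
  refine ⟨Matrix.of fun i k => A i k + if i = a then A b k else 0, ?_, ν', ?_, h2, ?_⟩
  · rw [← hA, ← Matrix.det_updateRow_add_self (A.map (Nat.cast : ℕ → ℤ)) hab]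
    congr 1
    ext i k
    by_cases hi : i = a
    · subst hi; simp
    · simp [hi]
  · intro i
    have hi := h1 i
    by_cases hia : i = a
    · subst hia
      have hb := h1 b
      simp [hab.symm] at hi hb
      simp [add_mul, Finset.sum_add_distrib]
      linarith
    · simpa [hia] using hi
  · intro j
    have := h3 j
    simp [add_mul, mul_add, Finset.sum_add_distrib] at this ⊢
    exact this

lemma perron_main {n : ℕ} (N : ℕ) : ∀ (ν : Fin n → ℝ) (c : Fin n → ℤ) (p q : ℕ)
    (_ : (p + q) * (n + 1) + (Finset.univ.filter fun k => c k = q ∨ c k = -p).card < N)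
    (_ : ∀ k, c k ≤ q) (_ : ∀ k, -(p : ℤ) ≤ c k)
    (_ : ∀ i, 0 < ν i)
    (_ : ∀ z : Fin n → ℤ, ∑ i, (z i : ℝ) * ν i = 0 → z = 0)
    (_ : 0 < ∑ i, (c i : ℝ) * ν i),
    ∃ A : Matrix (Fin n) (Fin n) ℕ,
      (A.map (Nat.cast : ℕ → ℤ)).det = 1 ∧
      ∃ ν' : Fin n → ℝ,
        (∀ i, ν i = ∑ j, (A i j : ℝ) * ν' j) ∧
        (∀ j, 0 < ν' j) ∧
        (∀ j : Fin n, 0 ≤ ∑ i, c i * (A i j : ℤ)) := by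
  induction N with
  | zero => intro _ _ _ _ h; omega
  | succ N ih =>
    intro ν c p q hN hq hp hν hz hc
    have hcard : ∀ s : Finset (Fin n), s.card ≤ n := fun s => by
      simpa using Finset.card_le_univ s
    rcases Nat.eq_zero_or_pos p with rfl | hp0
    · refine ⟨1, by simp, ν, ?_, hν, ?_⟩
      · intro i
        simp [Matrix.one_apply]
      · intro j
        have := hp j
        simpa [Matrix.one_apply] using this
    rcases Nat.eq_zero_or_pos q with rfl | hq0
    · exfalso
      refine absurd hc (not_lt.mpr (Finset.sum_nonpos fun i _ => ?_))
      have : (c i : ℝ) ≤ 0 := by exact_mod_cast hq i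
      exact mul_nonpos_of_nonpos_of_nonneg this (hν i).le
    by_cases hqa : ∃ i, c i = q
    swap
    · obtain ⟨q, rfl⟩ : ∃ r, q = r + 1 := ⟨q - 1, by omega⟩
      push Not at hqa
      refine ih ν c p q ?_ (fun k => ?_) hp hν hz hc
      · have := hcard (Finset.univ.filter fun k => c k = q ∨ c k = -p)
        have h2 : (p + (q + 1)) * (n + 1) = (p + q) * (n + 1) + (n + 1) := by ring
        omega
      · have := hq k
        have := hqa k
        push_cast at *
        omega
    by_cases hpa : ∃ i, c i = -p
    swap
    · obtain ⟨p, rfl⟩ : ∃ r, p = r + 1 := ⟨p - 1, by omega⟩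
      push Not at hpa
      refine ih ν c p q ?_ hq (fun k => ?_) hν hz hc
      · have := hcard (Finset.univ.filter fun k => c k = q ∨ c k = -p)
        have h2 : (p + 1 + q) * (n + 1) = (p + q) * (n + 1) + (n + 1) := by ring
        omega
      · have := hp k
        have := hpa k
        push_cast at *
        omega
    have key : ∀ a b : Fin n, a ≠ b → ν b < ν a → c a + c b = q - p →
        (c b = q ∨ c b = -p) → ∃ A : Matrix (Fin n) (Fin n) ℕ,
      (A.map (Nat.cast : ℕ → ℤ)).det = 1 ∧
      ∃ ν' : Fin n → ℝ,
        (∀ i, ν i = ∑ j, (A i j : ℝ) * ν' j) ∧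
        (∀ j, 0 < ν' j) ∧
        (∀ j : Fin n, 0 ≤ ∑ i, c i * (A i j : ℤ)) := by
      intro a b hab hlt hsum hb
      apply perron_step ν c a b hab
      apply ih (fun i => ν i - if i = a then ν b else 0)
        (fun i => c i + if i = b then c a else 0) p q
      · have : (Finset.univ.filter fun k => (c k + if k = b then c a else 0) = q ∨
            (c k + if k = b then c a else 0) = -p).card <
            (Finset.univ.filter fun k => c k = q ∨ c k = -p).card := by
          apply Finset.card_lt_card
          rw [Finset.ssubset_iff_of_subset]
          · refine ⟨b, by simpa using hb, ?_⟩
            simp only [Finset.mem_filter, Finset.mem_univ, true_and, if_true]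
            omega
          · intro k
            simp only [Finset.mem_filter, Finset.mem_univ, true_and]
            by_cases hk : k = b
            · subst hk
              exact fun _ => hb
            · simp [hk]
        omega
      · intro k
        have := hq k
        by_cases hk : k = b
        · subst hk; simp; omega
        · simpa [hk] using this
      · intro k
        have := hp k
        by_cases hk : k = b
        · subst hk; simp; omega
        · simpa [hk] using this
      · intro k
        by_cases hk : k = a
        · subst hk; simpa using hlt
        · simpa [hk] using hν k
      · intro z hzz
        have h0 := hz (fun i => z i - if i = b then z a else 0) (by
          simp [mul_sub, sub_mul, Finset.sum_sub_distrib] at hzz ⊢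
          linarith)
        have ha : z a = 0 := by simpa [hab] using congrFun h0 a
        funext k
        simpa [ha] using congrFun h0 k
      · have e1 : ∑ i, ((c i + if i = b then c a else 0 : ℤ) : ℝ) *
            (ν i - if i = a then ν b else 0) = ∑ i, (c i : ℝ) * ν i := by
          simp [mul_sub, add_mul, Finset.sum_sub_distrib, Finset.sum_add_distrib, hab]
        rw [e1]
        exact hc
    obtain ⟨i, hi⟩ := hqa
    obtain ⟨j, hj⟩ := hpa
    have hij : i ≠ j := by
      rintro rfl
      omega
    rcases lt_trichotomy (ν i) (ν j) with h | h | h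
    · exact key j i hij.symm h (by omega) (Or.inl hi)
    · exfalso
      have := congrFun (hz (fun k => (if k = i then 1 else 0) - if k = j then 1 else 0) (by
        simp [sub_mul, Finset.sum_sub_distrib, h])) i
      simp [hij] at this
    · exact key i j hij h (by omega) (Or.inr hj)

/-- **Lemma 11 (monomial domination via a Perron transform)** from
Cutkosky–Mourtada, "Defect and Local Uniformization".

Let `ν₁, …, νₙ` be positive real numbers, linearly independent over `ℚ`, and let
`d, e : Fin n → ℕ` satisfy `Σ dᵢ νᵢ < Σ eᵢ νᵢ`.  Then there is an `n × n` matrix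
`A = (a_{ij})` of natural numbers with determinant `1` such that the (unique) real solution
`ν'` of the system `νᵢ = Σⱼ a_{ij} νⱼ'` has all entries positive, and
`Σᵢ dᵢ a_{ij} ≤ Σᵢ eᵢ a_{ij}` for all `j`; that is, after the Perron substitution
`xᵢ = Πⱼ xⱼ(1)^{a_{ij}}` the monomial `x₁^{d₁} ⋯ xₙ^{dₙ}` divides `x₁^{e₁} ⋯ xₙ^{eₙ}`
in the new variables. -/
theorem perron_monomial_divides (n : ℕ) (ν : Fin n → ℝ)
    (hpos : ∀ i, 0 < ν i) (hind : LinearIndependent ℚ ν)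
    (d e : Fin n → ℕ)
    (hlt : ∑ i, (d i : ℝ) * ν i < ∑ i, (e i : ℝ) * ν i) :
    ∃ A : Matrix (Fin n) (Fin n) ℕ,
      (A.map (Nat.cast : ℕ → ℤ)).det = 1 ∧
      ∃ ν' : Fin n → ℝ,
        (∀ i, ν i = ∑ j, (A i j : ℝ) * ν' j) ∧
        (∀ j, 0 < ν' j) ∧
        (∀ j : Fin n, ∑ i, d i * A i j ≤ ∑ i, e i * A i j) := by
  have hz : ∀ z : Fin n → ℤ, ∑ i, (z i : ℝ) * ν i = 0 → z = 0 := by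
    intro z hz
    have := Fintype.linearIndependent_iff.mp hind (fun i => (z i : ℚ)) (by
      simpa [Rat.smul_def] using hz)
    funext i
    exact_mod_cast this i
  obtain ⟨A, hA, ν', h1, h2, h3⟩ := perron_main _ ν (fun i => (e i : ℤ) - d i)
    (∑ i, d i) (∑ i, e i) (Nat.lt_succ_self _)
    (fun k => by
      have := Finset.single_le_sum (f := e) (fun i _ => Nat.zero_le _) (Finset.mem_univ k)
      omega)
    (fun k => by
      have := Finset.single_le_sum (f := d) (fun i _ => Nat.zero_le _) (Finset.mem_univ k)
      omega)
    hpos hz (by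
      simp only [Int.cast_sub, Int.cast_natCast, sub_mul, Finset.sum_sub_distrib]
      linarith)
  refine ⟨A, hA, ν', h1, h2, fun j => ?_⟩
  have := h3 j
  simp only [sub_mul, Finset.sum_sub_distrib] at this
  zify
  linarith
end

section
/- Let k be a field, m ≥ 2, T = k[x₁,…,x_m] a polynomial ring, f ∈ T irreducible and monic as a polynomial in x_m, S = T/(f), K* the quotient field of S, and z ∈ K* the image of x_m. Let R = k[x₁,…,x_{m−1}] with quotient field K, so that K* is a finite extension of K; assume K* is separable over K. Let ν* be a rank-one valuation of K* (its value group Φ_{ν*} is a subgroup of ℝ) with restriction ν to K, such that k ⊆ V_{ν*}, the residue field V_{ν*}/m_{ν*} equals k, S ⊆ V_{ν*}, and the center of ν* on S is the maximal ideal generated by the images of x₁,…,x_m (equivalently, ν*(image of xᵢ) > 0 for all i). Let r denote the order (lowest degree of a nonzero term) of the univariate polynomial f(0,…,0,x_m) ∈ k[x_m]. Assume: (i) embedded local uniformization holds in dimension m−1 over k (as spelled out in the context); (ii) r > 1; and (iii) ν*(z) ∉ Φ_ν. Then there exist elements x₁',…,x_m' of the quotient field of T, algebraically independent over k, such that T ⊆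 T' = k[x₁',…,x_m'], T' has the same quotient field as T, f factors in T' as f = x₁'^{c₁}⋯x_m'^{c_m}·f' with c₁,…,c_m ∈ ℕ and f' ∈ T' irreducible and divisible by no xᵢ' (the strict transform of f), the domain S' = T'/(f') has quotient field K* and contains the image of S, ν* dominates the localization of S' at the maximal ideal generated by the images of x₁',…,x_m', and the order of f'(0,…,0,x_m') ∈ k[x_m'] is strictly less than r. -/
/-!
# Theorem 3 of Cutkosky–Mourtada, "Defect and Local Uniformization":
# reduction of multiplicity when `ν*(z) ∉ Φ_ν`

The hypersurface singularity is `S = T/(f)` where `T = k[x₁,…,x_m]`, realized here as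
`T = (MvPolynomial (Fin (m−1)) k)[X]` (so `x_m = X` and `xᵢ = C (Xᵢ)` for `i < m`), with
`f ∈ T` irreducible and monic in `x_m`.  The field `K*` is the quotient field of `S`,
presented by a ring homomorphism `π : T →+* K*` with kernel `(f)`; `z = π(x_m)`;
`K ⊆ K*` is the quotient field of `R = k[x₁,…,x_{m−1}]`, i.e. the subfield of `K*`
generated by `π(C(R))`.  The rank-one valuation `ν*` (whose value group is a subgroup
of `ℝ`) is given as an additive valuation `v` with values in `WithTop ℝ`.
-/

universe u

section Defs

variable {F : Type*} [Field F]

/-- `x` lies in the maximal ideal of the local subring (or valuation subring) of the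
field `F` whose underlying set is `S`: it belongs to `S` and is a nonunit of `S`. -/
def MemMaxSet (S : Set F) (x : F) : Prop := x ∈ S ∧ (x ≠ 0 → x⁻¹ ∉ S)

end Defs

/-- Embedded local uniformization holds in dimension `m` over the field `k`
(Definition `DefELU` of Cutkosky–Mourtada):  for every zero-dimensional valuation `μ` of
the quotient field `K₀` of the polynomial ring `A = k[y₁,…,y_m]`, trivial on `k`, which
dominates the local ring `A_{(y₁,…,y_m)}`, and every nonzero `g ∈ A`, there is a
birational extension `A → A₁ = k[y₁(1),…,y_m(1)]` such that `μ` dominates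
`(A₁)_{(y₁(1),…,y_m(1))}`, there is `n ≤ m` such that `μ(y₁(1)),…,μ(yₙ(1))` is a
rational basis of `Φ_μ ⊗ ℚ`, and `g = y₁(1)^{b₁} ⋯ yₙ(1)^{bₙ} ḡ` with `b i ∈ ℕ` and
`ḡ ∈ A₁ \ (y₁(1),…,y_m(1))`. -/
def ELU (k : Type u) [Field k] (m : ℕ) : Prop :=
  ∀ μ : ValuationSubring (FractionRing (MvPolynomial (Fin m) k)),
    (∀ c : k, algebraMap k (FractionRing (MvPolynomial (Fin m) k)) c ∈ μ) →
    (∀ x : FractionRing (MvPolynomial (Fin m) k), x ∈ μ →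
      ∃ p : Polynomial k, p ≠ 0 ∧ MemMaxSet (μ : Set _) (Polynomial.aeval x p)) →
    (∀ a b : MvPolynomial (Fin m) k, MvPolynomial.coeff 0 b ≠ 0 →
      algebraMap (MvPolynomial (Fin m) k) (FractionRing (MvPolynomial (Fin m) k)) a /
        algebraMap (MvPolynomial (Fin m) k) (FractionRing (MvPolynomial (Fin m) k)) b ∈ μ) →
    (∀ i : Fin m, MemMaxSet (μ : Set _)
      (algebraMap (MvPolynomial (Fin m) k) (FractionRing (MvPolynomial (Fin m) k))
        (MvPolynomial.X i))) →
    ∀ g : MvPolynomial (Fin m) k, g ≠ 0 →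
      ∃ y : Fin m → FractionRing (MvPolynomial (Fin m) k),
        AlgebraicIndependent k y ∧
        Set.range (algebraMap (MvPolynomial (Fin m) k)
            (FractionRing (MvPolynomial (Fin m) k))) ⊆
          (Algebra.adjoin k (Set.range y) : Set (FractionRing (MvPolynomial (Fin m) k))) ∧
        (∀ x : FractionRing (MvPolynomial (Fin m) k),
          ∃ a ∈ Algebra.adjoin k (Set.range y), ∃ b ∈ Algebra.adjoin k (Set.range y),
            b ≠ 0 ∧ x = a / b) ∧
        (∀ a b : MvPolynomial (Fin m) k, MvPolynomial.coeff 0 b ≠ 0 →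
          MvPolynomial.aeval y a / MvPolynomial.aeval y b ∈ μ) ∧
        (∀ i : Fin m, MemMaxSet (μ : Set _) (y i)) ∧
        ∃ n : ℕ, ∃ hn : n ≤ m,
          (∀ a : Fin n → ℤ,
            (∏ i : Fin n, μ.valuation (y (Fin.castLE hn i)) ^ a i) = 1 → a = 0) ∧
          (∀ x : FractionRing (MvPolynomial (Fin m) k), x ≠ 0 →
            ∃ N : ℕ, 0 < N ∧ ∃ a : Fin n → ℤ,
              μ.valuation x ^ (N : ℤ) =
                ∏ i : Fin n, μ.valuation (y (Fin.castLE hn i)) ^ a i) ∧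
          ∃ b : Fin n → ℕ, ∃ gbar : MvPolynomial (Fin m) k,
            MvPolynomial.coeff 0 gbar ≠ 0 ∧
            algebraMap (MvPolynomial (Fin m) k) (FractionRing (MvPolynomial (Fin m) k)) g =
              (∏ i : Fin n, y (Fin.castLE hn i) ^ b i) * MvPolynomial.aeval y gbar


namespace Perron

variable {ι : Type*} [DecidableEq ι]

/-- exponent move: `β_j += β_i` -/
def mv (i j : ι) : (ι → ℤ) →+ (ι → ℤ) where
  toFun d := d + Pi.single j (d i)
  map_zero' := by simp
  map_add' a b := by
    simp only [Pi.add_apply, Pi.single_add]; abel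

/-- Sequences of monomial blow-ups with centers in `S` along the weights `w`. -/
inductive Reach (S : Finset ι) (w0 : ι → ℝ) : (ι → ℝ) → ((ι → ℤ) →+ (ι → ℤ)) → Prop
  | refl : Reach S w0 w0 (AddMonoidHom.id _)
  | step {w : ι → ℝ} {Φ : (ι → ℤ) →+ (ι → ℤ)} (i j : ι) (hi : i ∈ S) (hj : j ∈ S)
      (hij : i ≠ j) (h : w j < w i) (hr : Reach S w0 w Φ) :
      Reach S w0 (w - Pi.single i (w j)) ((mv i j).comp Φ)

/-- weight -/
def wt (S : Finset ι) (w : ι → ℝ) (d : ι → ℤ) : ℝ := ∑ l ∈ S, w l * (d l : ℝ)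

def Indep (S : Finset ι) (w : ι → ℝ) : Prop :=
  ∀ c : ι → ℤ, wt S w c = 0 → ∀ l ∈ S, c l = 0

lemma wt_add (S : Finset ι) (w : ι → ℝ) (c d : ι → ℤ) : wt S w (c + d) = wt S w c + wt S w d := by
  simp [wt, mul_add, Finset.sum_add_distrib]

lemma wt_sub (S : Finset ι) (w : ι → ℝ) (c d : ι → ℤ) : wt S w (c - d) = wt S w c - wt S w d := by
  simp [wt, mul_sub, Finset.sum_sub_distrib]

lemma wt_smul (S : Finset ι) (w : ι → ℝ) (c : ℤ) (d : ι → ℤ) : wt S w (c • d) = c * wt S w d := by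
  simp only [wt, Finset.mul_sum, Pi.smul_apply, smul_eq_mul, Int.cast_mul]
  exact Finset.sum_congr rfl fun l _ => by ring

lemma wt_congr (S : Finset ι) {w w' : ι → ℝ} {c d : ι → ℤ} (h : ∀ l ∈ S, w l = w' l)
    (h' : ∀ l ∈ S, c l = d l) : wt S w c = wt S w' d :=
  Finset.sum_congr rfl fun l hl => by rw [h l hl, h' l hl]

lemma wt_nonneg (S : Finset ι) {w : ι → ℝ} (hw : ∀ l, 0 < w l) {d : ι → ℤ}
    (hd : ∀ l ∈ S, 0 ≤ d l) : 0 ≤ wt S w d :=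
  Finset.sum_nonneg fun l hl => mul_nonneg (hw l).le (by exact_mod_cast hd l hl)

lemma wt_single (S : Finset ι) (w : ι → ℝ) (i : ι) (hi : i ∈ S) (c : ℤ) :
    wt S w (Pi.single i c) = w i * c := by
  unfold wt
  rw [Finset.sum_eq_single i]
  · simp
  · intro b _ hb; simp [hb]
  · intro h; exact absurd hi h

lemma wt_insert (S : Finset ι) (w : ι → ℝ) (i : ι) (hi : i ∉ S) (d : ι → ℤ) :
    wt (insert i S) w d = w i * d i + wt S w d := by
  unfold wt; rw [Finset.sum_insert hi]

lemma wt_step (S : Finset ι) (w : ι → ℝ) (i j : ι) (hi : i ∈ S) (hj : j ∈ S) (hij : i ≠ j)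
    (d : ι → ℤ) : wt S (w - Pi.single i (w j)) (mv i j d) = wt S w d := by
  have h1 : wt S (w - Pi.single i (w j)) (mv i j d)
      = wt S w (mv i j d) - ∑ l ∈ S, (Pi.single i (w j) : ι → ℝ) l * (mv i j d l : ℝ) := by
    simp [wt, sub_mul, Finset.sum_sub_distrib]
  have h2 : ∑ l ∈ S, (Pi.single i (w j) : ι → ℝ) l * (mv i j d l : ℝ) = w j * d i := by
    rw [Finset.sum_eq_single i]
    · simp [mv, hij]
    · intro b _ hb; simp [hb]
    · intro h; exact absurd hi h
  have h3 : wt S w (mv i j d) = wt S w d + w j * d i := by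
    change wt S w (d + Pi.single j (d i)) = _
    rw [wt_add, wt_single S w j hj]
  rw [h1, h2, h3]; ring

namespace Reach

variable {S : Finset ι} {w w' w'' : ι → ℝ} {Φ Ψ : (ι → ℤ) →+ (ι → ℤ)}

lemma trans (h : Reach S w w' Φ) (h' : Reach S w' w'' Ψ) : Reach S w w'' (Ψ.comp Φ) := by
  induction h' with
  | refl => simpa using h
  | step i j hi hj hij hlt _ ih => exact Reach.step i j hi hj hij hlt ih

lemma mono {S' : Finset ι} (hS : S ⊆ S') (h : Reach S w w' Φ) : Reach S' w w' Φ := by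
  induction h with
  | refl => exact .refl
  | step i j hi hj hij hlt _ ih => exact .step i j (hS hi) (hS hj) hij hlt ih

lemma pos (h : Reach S w w' Φ) (hw : ∀ l, 0 < w l) : ∀ l, 0 < w' l := by
  induction h with
  | refl => exact hw
  | step i j hi hj hij hlt _ ih =>
    intro l
    by_cases hl : l = i
    · subst hl; simpa using hlt
    · simpa [hl] using ih l

lemma weight (h : Reach S w w' Φ) (d : ι → ℤ) : wt S w' (Φ d) = wt S w d := by
  induction h with
  | refl => rfl
  | step i j hi hj hij hlt _ ih =>
    rw [← ih]; exact wt_step S _ i j hi hj hij _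

lemma out (h : Reach S w w' Φ) (d : ι → ℤ) {l : ι} (hl : l ∉ S) : Φ d l = d l := by
  induction h with
  | refl => rfl
  | step i j hi hj hij hlt _ ih =>
    have : l ≠ j := fun h => hl (h ▸ hj)
    simp [mv, this, ih]

lemma outw (h : Reach S w w' Φ) {l : ι} (hl : l ∉ S) : w' l = w l := by
  induction h with
  | refl => rfl
  | step i j hi hj hij hlt _ ih =>
    have : l ≠ i := fun h => hl (h ▸ hi)
    simp [this, ih]

lemma nonneg (h : Reach S w w' Φ) {d : ι → ℤ} (hd : ∀ l ∈ S, 0 ≤ d l) : ∀ l ∈ S, 0 ≤ Φ d l := by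
  induction h with
  | refl => exact hd
  | step i j hi hj hij hlt _ ih =>
    intro l hl
    by_cases hlj : l = j
    · subst hlj
      simpa [mv] using add_nonneg (ih l hl) (ih i hi)
    · simpa [mv, hlj] using ih l hl

lemma surj (h : Reach S w w' Φ) (d : ι → ℤ) : ∃ c, Φ c = d := by
  induction h generalizing d with
  | refl => exact ⟨d, rfl⟩
  | step i j hi hj hij hlt _ ih =>
    obtain ⟨c, hc⟩ := ih (d - Pi.single j (d i))
    refine ⟨c, ?_⟩
    simp only [AddMonoidHom.comp_apply, hc]
    change d - Pi.single j (d i) + Pi.single j ((d - Pi.single j (d i) : ι → ℤ) i) = d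
    simp [hij]

lemma zero_of_zero (h : Reach S w w' Φ) {d : ι → ℤ} (hd : ∀ l ∈ S, d l = 0) :
    ∀ l ∈ S, Φ d l = 0 := by
  intro l hl
  have h1 := h.nonneg (d := d) (fun l hl => (hd l hl).ge) l hl
  have h2 := h.nonneg (d := -d) (fun l hl => by simp [hd l hl]) l hl
  rw [map_neg] at h2
  simp at h2
  omega

lemma indep (h : Reach S w w' Φ) (hI : Indep S w) : Indep S w' := by
  intro c hc
  obtain ⟨d, rfl⟩ := h.surj c
  rw [h.weight] at hc
  exact h.zero_of_zero (hI d hc)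

end Reach

lemma indep_ne {S : Finset ι} {w : ι → ℝ} (hI : Indep S w) {i j : ι} (hi : i ∈ S) (hj : j ∈ S)
    (hij : i ≠ j) : w i ≠ w j := by
  intro h
  have := hI (Pi.single i 1 - Pi.single j 1) (by
    rw [wt_sub, wt_single S w i hi, wt_single S w j hj, h]; ring) i hi
  simp [hij] at this

lemma indep_ne_zero {S : Finset ι} {w : ι → ℝ} (hI : Indep S w) {i : ι} (hi : i ∈ S) :
    w i ≠ 0 := by
  intro h
  have := hI (Pi.single i 1) (by rw [wt_single S w i hi, h]; ring) i hi
  simp at this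

/-- Perron transformation, one vector, with bounds. -/
lemma perron_aux (S : Finset ι) (K : ℕ) : ∀ (N : ℕ) (A B : ℕ) (_ : A + B = K)
    (w : ι → ℝ) (_ : ∀ l, 0 < w l) (_ : Indep S w) (d : ι → ℤ) (_ : 0 < wt S w d)
    (_ : ∀ l ∈ S, -(A : ℤ) ≤ d l ∧ d l ≤ B)
    (_ : (S.filter fun l => d l = -(A : ℤ) ∨ d l = B).card ≤ N),
    ∃ w' Φ, Reach S w w' Φ ∧ ∀ l ∈ S, 0 ≤ Φ d l := by
  induction K using Nat.strong_induction_on with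
  | _ K ihK =>
  intro N
  induction N using Nat.strong_induction_on with
  | _ N ihN =>
  intro A B hAB w hw hI d hd hb hN
  -- A = 0
  rcases Nat.eq_zero_or_pos A with hA | hA
  · subst hA
    exact ⟨w, _, .refl, fun l hl => by simpa using (hb l hl).1⟩
  rcases Nat.eq_zero_or_pos B with hB | hB
  · subst hB
    exfalso
    have : wt S w d ≤ 0 := Finset.sum_nonpos fun l hl =>
      mul_nonpos_of_nonneg_of_nonpos (hw l).le (by exact_mod_cast (hb l hl).2)
    linarith
  by_cases h1 : ∃ j ∈ S, d j = -(A : ℤ)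
  swap
  · push Not at h1
    refine ihK (A - 1 + B) (by omega) _ (A - 1) B rfl w hw hI d hd (fun l hl => ?_) le_rfl
    have := hb l hl; have := h1 l hl
    omega
  by_cases h2 : ∃ i ∈ S, d i = B
  swap
  · push Not at h2
    refine ihK (A + (B - 1)) (by omega) _ A (B - 1) rfl w hw hI d hd (fun l hl => ?_) le_rfl
    have := hb l hl; have := h2 l hl
    omega
  obtain ⟨j, hj, hdj⟩ := h1
  obtain ⟨i, hi, hdi⟩ := h2
  have hij : i ≠ j := by rintro rfl; omega
  -- generic continuation
  have key : ∀ a b : ι, a ∈ S → b ∈ S → a ≠ b → (d a = B ∧ d b = -A ∨ d a = -A ∧ d b = B) →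
      w b < w a → ∃ w' Φ, Reach S w w' Φ ∧ ∀ l ∈ S, 0 ≤ Φ d l := by
    intro a b ha hb' hab hdab hlt
    have hr : Reach S w _ _ := Reach.step a b ha hb' hab hlt .refl
    have hmv : ∀ l, l ≠ b → mv a b d l = d l := fun l hl => by simp [mv, hl]
    have hmvb : mv a b d b = (B : ℤ) - A := by
      rcases hdab with h | h <;> simp [mv, h.1, h.2] <;> ring
    have hd' : 0 < wt S (w - Pi.single a (w b)) (mv a b d) := by
      rw [wt_step S w a b ha hb' hab]; exact hd
    have hlt' : (S.filter fun l => mv a b d l = -(A : ℤ) ∨ mv a b d l = B).card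
        < (S.filter fun l => d l = -(A : ℤ) ∨ d l = B).card := by
      apply Finset.card_lt_card
      rw [Finset.ssubset_iff_of_subset]
      · refine ⟨b, ?_, ?_⟩
        · simp only [Finset.mem_filter]; refine ⟨hb', ?_⟩; tauto
        · simp only [Finset.mem_filter, hmvb]; omega
      · intro l hl
        simp only [Finset.mem_filter] at hl ⊢
        refine ⟨hl.1, ?_⟩
        by_cases h : l = b
        · subst h; tauto
        · rw [hmv l h] at hl; exact hl.2
    obtain ⟨w', Φ, h1, h2⟩ := ihN _ (lt_of_lt_of_le hlt' hN) A B hAB _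
      (hr.pos hw) (hr.indep hI) (mv a b d) hd' (fun l hl => by
        by_cases h : l = b
        · subst h; rw [hmvb]; omega
        · rw [hmv l h]; exact hb l hl) le_rfl
    exact ⟨w', _, hr.trans h1, h2⟩
  rcases lt_or_gt_of_ne (indep_ne hI hi hj hij) with h | h
  · exact key j i hj hi hij.symm (Or.inr ⟨hdj, hdi⟩) h
  · exact key i j hi hj hij (Or.inl ⟨hdi, hdj⟩) h

lemma perron_one (S : Finset ι) (w : ι → ℝ) (hw : ∀ l, 0 < w l) (hI : Indep S w) (d : ι → ℤ)
    (hd : 0 ≤ wt S w d) : ∃ w' Φ, Reach S w w' Φ ∧ ∀ l ∈ S, 0 ≤ Φ d l := by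
  rcases hd.eq_or_lt with h | h
  · exact ⟨w, _, .refl, fun l hl => (hI d h.symm l hl).ge⟩
  · refine perron_aux S _ _ (∑ l ∈ S, (d l).natAbs) (∑ l ∈ S, (d l).natAbs) rfl w hw hI d h
      (fun l hl => ?_) le_rfl
    have := Finset.single_le_sum (f := fun l => (d l).natAbs) (fun _ _ => Nat.zero_le _) hl
    omega

lemma perron {κ : Type*} (S : Finset ι) (w : ι → ℝ) (hw : ∀ l, 0 < w l) (hI : Indep S w)
    (D : Finset κ) (d : κ → ι → ℤ) (hd : ∀ a ∈ D, 0 ≤ wt S w (d a)) :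
    ∃ w' Φ, Reach S w w' Φ ∧ ∀ a ∈ D, ∀ l ∈ S, 0 ≤ Φ (d a) l := by
  classical
  induction D using Finset.induction_on with
  | empty => exact ⟨w, _, .refl, by simp⟩
  | insert a D ha ih =>
    obtain ⟨w1, Φ1, h1, h2⟩ := ih fun b hb => hd b (Finset.mem_insert_of_mem hb)
    obtain ⟨w2, Φ2, h3, h4⟩ := perron_one S w1 (h1.pos hw) (h1.indep hI) (Φ1 (d a))
      (by rw [h1.weight]; exact hd a (Finset.mem_insert_self _ _))
    refine ⟨w2, _, h1.trans h3, fun b hb => ?_⟩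
    rcases Finset.mem_insert.1 hb with rfl | hb
    · exact h4
    · exact h3.nonneg (h2 b hb)

/-- divide the variable `t` by the monomial `q` in the variables of `S`. -/
lemma subtract (S : Finset ι) (t : ι) (ht : t ∉ S) : ∀ (n : ℕ) (q : ι → ℤ) (w : ι → ℝ),
    (∀ l, 0 < w l) → (∀ l ∈ S, 0 ≤ q l) → ∑ l ∈ S, q l = n → wt S w q < w t →
    ∃ w' Φ, Reach (insert t S) w w' Φ ∧ (∀ l, l ≠ t → w' l = w l) ∧ w' t = w t - wt S w q ∧
      (∀ d l, l ∈ S → Φ d l = d l + d t * q l) ∧ (∀ d l, l ∉ S → Φ d l = d l) := by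
  intro n
  induction n with
  | zero =>
    intro q w hw hq hs hlt
    have hz : ∀ l ∈ S, q l = 0 := (Finset.sum_eq_zero_iff_of_nonneg hq).1 (by simpa using hs)
    have : wt S w q = 0 := Finset.sum_eq_zero fun l hl => by simp [hz l hl]
    exact ⟨w, _, .refl, fun _ _ => rfl, by rw [this]; ring, fun d l hl => by simp [hz l hl],
      fun _ _ _ => rfl⟩
  | succ n ih =>
    intro q w hw hq hs hlt
    obtain ⟨a, ha, hqa⟩ : ∃ a ∈ S, 0 < q a := by
      by_contra hcon
      push Not at hcon
      have : ∑ l ∈ S, q l ≤ 0 := Finset.sum_nonpos hcon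
      push_cast at hs; omega
    have hta : t ≠ a := fun h => ht (h ▸ ha)
    have hq' : ∀ l ∈ S, 0 ≤ (q - Pi.single a 1 : ι → ℤ) l := by
      intro l hl
      by_cases h : l = a
      · subst h; simp; omega
      · simpa [h] using hq l hl
    have hwq : wt S w (q - Pi.single a 1) = wt S w q - w a := by
      rw [wt_sub, wt_single S w a ha]; simp
    have hlt1 : w a < w t := by
      have := wt_nonneg S hw hq'
      linarith
    have hr : Reach (insert t S) w _ _ := Reach.step t a (by simp) (by simp [ha]) hta hlt1 .refl
    have hwS : wt S (w - Pi.single t (w a)) (q - Pi.single a 1) = wt S w q - w a := by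
      rw [← hwq]
      refine wt_congr S (fun l hl => ?_) (fun _ _ => rfl)
      have : l ≠ t := fun h => ht (h ▸ hl)
      simp [this]
    obtain ⟨w', Φ, h1, h2, h3, h4, h5⟩ := ih (q - Pi.single a 1) _ (hr.pos hw) hq' (by
      simp [Finset.sum_sub_distrib, hs, ha]) (by
      rw [hwS]; simp; linarith)
    refine ⟨w', _, hr.trans h1, fun l hl => ?_, ?_, fun d l hl => ?_, fun d l hl => ?_⟩
    · rw [h2 l hl]; simp [hl]
    · rw [h3, hwS]; simp
    · simp only [AddMonoidHom.comp_apply, AddMonoidHom.id_apply]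
      rw [h4 _ l hl]
      by_cases h : l = a
      · subst h; simp [mv, hta]; ring
      · simp [mv, h, hta]
    · simp only [AddMonoidHom.comp_apply, AddMonoidHom.id_apply]
      rw [h5 _ l hl]
      have : l ≠ a := fun h => hl (h ▸ ha)
      simp [mv, this]

def Good (S : Finset ι) (w : ι → ℝ) (J : Finset ℕ) (β : ℕ → ι → ℤ) (r : ℕ) : Prop :=
  ∃ w' Φ, Reach S w w' Φ ∧ ∃ m0, ∃ j0 ∈ J, ∀ j ∈ J,
    (∀ l, l ≠ m0 → Φ (β j0) l ≤ Φ (β j) l) ∧ Φ (β j0) m0 < r + Φ (β j) m0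

lemma Good.of_reach {S : Finset ι} {w w1 : ι → ℝ} {Ψ : (ι → ℤ) →+ (ι → ℤ)} {J : Finset ℕ}
    {β : ℕ → ι → ℤ} {r : ℕ} (h : Reach S w w1 Ψ) (hg : Good S w1 J (fun j => Ψ (β j)) r) :
    Good S w J β r := by
  obtain ⟨w', Φ, h1, h2⟩ := hg
  exact ⟨w', _, h.trans h1, h2⟩

lemma exists_lexmin (J : Finset ℕ) (hJ : J.Nonempty) (f : ℕ → ℝ) (g : ℕ → ℤ) :
    ∃ j ∈ J, (∀ j' ∈ J, f j ≤ f j') ∧ ∀ j' ∈ J, f j' = f j → g j ≤ g j' := by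
  obtain ⟨a, ha, hmin⟩ := J.exists_min_image f hJ
  obtain ⟨b, hb, hmin'⟩ := (J.filter fun j => f j = f a).exists_min_image g ⟨a, by simp [ha]⟩
  simp only [Finset.mem_filter] at hb hmin'
  exact ⟨b, hb.1, fun j' hj' => hb.2 ▸ hmin j' hj', fun j' hj' h => hmin' j' ⟨hj', h.trans hb.2⟩⟩

lemma principle (S : Finset ι) (t : ι) (ht : t ∉ S) (w : ι → ℝ) (hw : ∀ l, 0 < w l)
    (hI : Indep S w) (J : Finset ℕ) (hJ : J.Nonempty) (β : ℕ → ι → ℤ) (r : ℕ)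
    (hout : ∀ j ∈ J, ∀ l, l ∉ insert t S → β j l = 0)
    (κ : ι → ℤ) (hκ0 : 0 ≤ wt S w κ) (hκ : wt S w κ < w t)
    (H : ∀ j ∈ J, (∀ j' ∈ J, wt S w (β j) + β j t * wt S w κ ≤ wt S w (β j') + β j' t * wt S w κ) →
      (∀ j' ∈ J, wt S w (β j') + β j' t * wt S w κ = wt S w (β j) + β j t * wt S w κ →
        β j t ≤ β j' t) → ∀ j' ∈ J, β j t < r + β j' t) :
    Good (insert t S) w J β r := by
  obtain ⟨w1, Φ1, r1, hκ1⟩ := perron_one S w hw hI κ hκ0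
  have hw1t : w1 t = w t := r1.outw ht
  obtain ⟨n, hn⟩ : ∃ n : ℕ, ∑ l ∈ S, Φ1 κ l = n :=
    ⟨_, (Int.toNat_of_nonneg (Finset.sum_nonneg hκ1)).symm⟩
  obtain ⟨w2, Φ2, r2, hw2, hw2t, hΦ2, hΦ2'⟩ := subtract S t ht n (Φ1 κ) w1 (r1.pos hw) hκ1 hn
    (by rw [r1.weight, hw1t]; exact hκ)
  have hI2 : Indep S w2 := by
    intro c hc
    refine r1.indep hI c ?_
    rw [← hc]
    exact wt_congr S (fun l hl => (hw2 l fun h => ht (h ▸ hl)).symm) fun _ _ => rfl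
  have hwt : ∀ d, wt S w2 (Φ2 (Φ1 d)) = wt S w d + d t * wt S w κ := by
    intro d
    have : wt S w2 (Φ2 (Φ1 d)) = wt S w1 (Φ1 d + (d t) • Φ1 κ) := by
      refine wt_congr S (fun l hl => hw2 l fun h => ht (h ▸ hl)) fun l hl => ?_
      rw [hΦ2 _ l hl, r1.out d ht]; simp
    rw [this, wt_add, wt_smul, r1.weight, r1.weight]
  have hpos2 := r2.pos (r1.pos hw)
  obtain ⟨j0, hj0, hm1, hm2⟩ := exists_lexmin J hJ
    (fun j => wt S w (β j) + β j t * wt S w κ) (fun j => β j t)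
  obtain ⟨w3, Φ3, r3, h3⟩ := perron S w2 hpos2 hI2 J (fun j => Φ2 (Φ1 (β j)) - Φ2 (Φ1 (β j0)))
    (fun j hj => by
      simp only [wt_sub, hwt]
      have := hm1 j hj
      linarith)
  refine ⟨w3, _, ((r1.mono (Finset.subset_insert _ _)).trans r2).trans
    (r3.mono (Finset.subset_insert _ _)), t, j0, hj0, fun j hj => ⟨fun l hl => ?_, ?_⟩⟩
  · simp only [AddMonoidHom.comp_apply]
    by_cases hlS : l ∈ S
    · have := h3 j hj l hlS
      rw [map_sub] at this
      simpa using this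
    · have hlS' : l ∉ insert t S := by simp [hl, hlS]
      rw [r3.out _ hlS, r3.out _ hlS, r2.out _ hlS', r2.out _ hlS', r1.out _ hlS, r1.out _ hlS,
        hout j0 hj0 l hlS', hout j hj l hlS']
  · simp only [AddMonoidHom.comp_apply]
    rw [r3.out _ ht, r3.out _ ht, hΦ2' _ t ht, hΦ2' _ t ht, r1.out _ ht, r1.out _ ht]
    exact H j0 hj0 hm1 hm2 j hj

lemma dense (S : Finset ι) (w : ι → ℝ) (hI : Indep S w) {a b : ι} (ha : a ∈ S) (hb : b ∈ S)
    (hab : a ≠ b) (x y : ℝ) (hxy : x < y) : ∃ κ, x < wt S w κ ∧ wt S w κ < y := by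
  let hom : (ι → ℤ) →+ ℝ := ⟨⟨wt S w, by simp [wt]⟩, wt_add S w⟩
  rcases AddSubgroup.dense_or_cyclic hom.range with h | ⟨g, hg⟩
  · obtain ⟨u, ⟨κ, hκ⟩, h1, h2⟩ := h.exists_between hxy
    exact ⟨κ, by rw [← hκ] at h1; exact h1, by rw [← hκ] at h2; exact h2⟩
  · exfalso
    have hmem : ∀ i ∈ S, ∃ n : ℤ, w i = n * g := by
      intro i hi
      have : w i ∈ hom.range := ⟨Pi.single i 1, by
        change wt S w _ = _; rw [wt_single S w i hi]; simp⟩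
      rw [hg, AddSubgroup.mem_closure_singleton] at this
      obtain ⟨n, hn⟩ := this
      exact ⟨n, by rw [← hn]; simp⟩
    obtain ⟨n, hn⟩ := hmem a ha
    obtain ⟨p, hp⟩ := hmem b hb
    have h1 := hI (Pi.single a p - Pi.single b n) (by
      rw [wt_sub, wt_single S w a ha, wt_single S w b hb, hn, hp]; ring) b hb
    simp [hab.symm] at h1
    exact indep_ne_zero hI ha (by rw [hn, h1]; simp)

end Perron


namespace Perron

variable {ι : Type*} [DecidableEq ι]

lemma caseB (A : Finset ι) (z : ι) (hzA : z ∉ A) (w : ι → ℝ) (hw : ∀ l, 0 < w l)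
    (hI : Indep A w) (hz : ∀ q, wt A w q ≠ w z) (J : Finset ℕ) (β : ℕ → ι → ℤ) (r : ℕ)
    (hβz : ∀ j ∈ J, β j z = j) (hnn : ∀ j ∈ J, ∀ l ∈ A, 0 ≤ β j l)
    (hout : ∀ j ∈ J, ∀ l, l ∉ insert z A → β j l = 0)
    (hrJ : r ∈ J) (hβr : ∀ l ∈ A, β r l = 0)
    (j1 : ℕ) (hj1 : j1 ∈ J) (hj1r : j1 < r)
    (hδ : wt A w (β j1) ≤ ((r : ℝ) - j1) * w z)
    (hdiv : ∀ j ∈ J, j < r → ∀ l ∈ A, ((r : ℤ) - j) * β j1 l ≤ ((r : ℤ) - j1) * β j l)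
    (hB : ∀ q, wt A w (β j1) ≤ ((r : ℝ) - j1) * wt A w q → w z ≤ wt A w q) :
    Good (insert z A) w J β r := by
  obtain ⟨s, hs⟩ : ∃ s : ℤ, s = (r : ℤ) - j1 := ⟨_, rfl⟩
  have hsR : (s : ℝ) = (r : ℝ) - j1 := by rw [hs]; push_cast; ring
  rw [← hsR] at hδ
  simp only [← hsR] at hB
  simp only [← hs] at hdiv
  have hs0 : 0 < s := by omega
  have hs0R : (0 : ℝ) < s := by exact_mod_cast hs0
  obtain ⟨q, hq⟩ : ∃ q : ι → ℤ, q = fun l => β j1 l / s := ⟨_, rfl⟩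
  obtain ⟨e, he⟩ : ∃ e : ι → ℤ, e = β j1 - s • q := ⟨_, rfl⟩
  have heq : ∀ l, e l = β j1 l % s := by
    intro l; rw [he, hq]; simp [Int.emod_def]
  have he0 : ∀ l, 0 ≤ e l := fun l => by rw [heq]; exact Int.emod_nonneg _ hs0.ne'
  have hes : ∀ l, e l < s := fun l => by rw [heq]; exact Int.emod_lt_of_pos _ hs0
  have hel : ∀ l, β j1 l = e l + s * q l := by intro l; rw [he]; simp
  have hq0 : ∀ l ∈ A, 0 ≤ q l := fun l hl => by
    rw [hq]; exact Int.ediv_nonneg (hnn j1 hj1 l hl) hs0.le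
  have hwe : wt A w e = wt A w (β j1) - s * wt A w q := by rw [he, wt_sub, wt_smul]
  have hwe0 : 0 ≤ wt A w e := wt_nonneg A hw fun l _ => he0 l
  have hqz : wt A w q < w z := by
    refine lt_of_le_of_ne ?_ (hz q)
    refine le_of_mul_le_mul_left ?_ hs0R
    linarith
  obtain ⟨n, hn⟩ : ∃ n : ℕ, ∑ l ∈ A, q l = n :=
    ⟨_, (Int.toNat_of_nonneg (Finset.sum_nonneg hq0)).symm⟩
  obtain ⟨w2, Φ2, r2, hw2, hw2z, hΦ2, hΦ2'⟩ := subtract A z hzA n q w hw hq0 hn hqz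
  obtain ⟨y1, hy1, hey1⟩ : ∃ y1 ∈ A, e y1 ≠ 0 := by
    by_contra hcon
    push Not at hcon
    have h0 : wt A w e = 0 := Finset.sum_eq_zero fun l hl => by simp [hcon l hl]
    have := hB q (by linarith)
    linarith
  have hzy : z ≠ y1 := fun h => hzA (h ▸ hy1)
  obtain ⟨A', hA'⟩ : ∃ A', A' = A.erase y1 := ⟨_, rfl⟩
  have hy1A' : y1 ∉ A' := by simp [hA']
  have hAA' : A = insert y1 A' := by rw [hA', Finset.insert_erase hy1]
  have hzA' : z ∉ A' := fun h => hzA (by rw [hAA']; exact Finset.mem_insert_of_mem h)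
  have hA'A : ∀ l ∈ A', l ∈ A := fun l hl => by rw [hAA']; exact Finset.mem_insert_of_mem hl
  have hy1S : y1 ∉ insert z A' := by simp [hzy.symm, hy1A']
  have hSS : insert z A = insert y1 (insert z A') := by
    rw [hAA', Finset.insert_comm]
  have hwA : ∀ d, wt A w d = w y1 * d y1 + wt A' w d := by
    intro d
    conv_lhs => rw [hAA']
    exact wt_insert A' w y1 hy1A' d
  have hw2y : w2 y1 = w y1 := hw2 y1 hzy.symm
  have hwA2 : ∀ d, wt A' w2 d = wt A' w d := fun d =>
    wt_congr A' (fun l hl => hw2 l fun h => hzA' (h ▸ hl)) fun _ _ => rfl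
  have hwS : ∀ d, wt (insert z A') w2 d = w2 z * d z + wt A' w d := by
    intro d; rw [wt_insert A' w2 z hzA', hwA2]
  have hpos2 := r2.pos hw
  have hE := hwA e
  have hey1' : (0 : ℝ) < e y1 := by
    have := he0 y1
    exact_mod_cast (by omega : 0 < e y1)
  have hey1s : (e y1 : ℝ) < s := by exact_mod_cast hes y1
  have hE0 : 0 ≤ wt A' w e := wt_nonneg A' hw fun l _ => he0 l
  have hle : wt A w e ≤ s * w2 z := by rw [hwe, hw2z]; linarith
  have hZpos : 0 < s * w2 z - wt A' w e := by
    have := mul_pos (hw y1) hey1'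
    linarith
  have hmain : Indep (insert z A') w2 ∧ ∃ κ, s * w2 z - wt A' w e ≤ s * wt (insert z A') w2 κ ∧
      wt (insert z A') w2 κ < w2 y1 := by
    rcases A'.eq_empty_or_nonempty with hemp | ⟨b, hb⟩
    · have h0 : ∀ d, wt A' w d = 0 := by intro d; rw [hemp]; simp [wt]
      refine ⟨?_, Pi.single z 1, ?_, ?_⟩
      · intro c hc l hl
        rw [hwS, h0] at hc
        have : l = z := by simpa [hemp] using hl
        subst this
        have := (hpos2 l).ne'
        simpa [this] using hc
      · rw [hwS, h0, h0]; simp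
      · rw [hwS, h0]
        simp only [Pi.single_eq_same, Int.cast_one, mul_one, add_zero]
        rw [hw2y, hw2z]
        have hsum : wt A w (q + Pi.single y1 1) = wt A w q + w y1 := by
          rw [wt_add, wt_single A w y1 hy1]; simp
        have h1 := hB (q + Pi.single y1 1) (by
          rw [hsum]
          rw [h0] at hE
          have : w y1 * e y1 ≤ w y1 * s := mul_le_mul_of_nonneg_left hey1s.le (hw y1).le
          nlinarith)
        have h2 := hz (q + Pi.single y1 1)
        have h3 := lt_of_le_of_ne h1 h2.symm
        rw [hsum] at h3
        linarith
    · have hby : y1 ≠ b := fun h => hy1A' (h ▸ hb)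
      have hbz : z ≠ b := fun h => hzA' (h ▸ hb)
      have heqz : wt A w e = s * w2 z := by
        by_contra hne
        have hlt := lt_of_le_of_ne hle hne
        obtain ⟨κ, h1, h2⟩ := dense A w hI hy1 (hA'A b hb) hby (wt A w (β j1) / s) (w z) (by
          rw [div_lt_iff₀ hs0R]
          rw [hwe, hw2z] at hlt
          linarith)
        rw [div_lt_iff₀ hs0R] at h1
        have := hB κ (by linarith)
        linarith
      have hInd : Indep (insert z A') w2 := by
        intro c hc
        rw [hwS] at hc
        have hC := hI (c z • e + s • Function.update c y1 0) (by
          rw [wt_add, wt_smul, wt_smul, heqz, hwA (Function.update c y1 0)]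
          have : wt A' w (Function.update c y1 0) = wt A' w c :=
            wt_congr A' (fun _ _ => rfl) fun l hl => by
              have : l ≠ y1 := fun h => hy1A' (h ▸ hl)
              simp [this]
          rw [this]
          simp only [Function.update_self, Int.cast_zero, mul_zero, zero_add]
          linear_combination (s : ℝ) * hc)
        have hcz : c z = 0 := by
          have := hC y1 hy1
          simpa [hey1] using this
        intro l hl
        rcases Finset.mem_insert.1 hl with rfl | hl
        · exact hcz
        · have := hC l (hA'A l hl)
          have hly : l ≠ y1 := fun h => hy1A' (h ▸ hl)
          simpa [hcz, hly, hs0.ne'] using this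
      refine ⟨hInd, ?_⟩
      obtain ⟨κ, h1, h2⟩ := dense (insert z A') w2 hInd (Finset.mem_insert_self _ _)
        (Finset.mem_insert_of_mem hb) hbz ((s * w2 z - wt A' w e) / s) (w2 y1) (by
          rw [div_lt_iff₀ hs0R, hw2y]
          have := mul_lt_mul_of_pos_left hey1s (hw y1)
          linarith)
      rw [div_lt_iff₀ hs0R] at h1
      exact ⟨κ, by linarith, h2⟩
  obtain ⟨hInd, κ, hκ1, hκ2⟩ := hmain
  obtain ⟨K, hK⟩ : ∃ K, K = wt (insert z A') w2 κ := ⟨_, rfl⟩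
  have hK0 : 0 < K := by
    rw [hK]
    by_contra hcon
    push Not at hcon
    have := mul_nonpos_of_nonneg_of_nonpos hs0R.le hcon
    linarith
  refine Good.of_reach r2 ?_
  rw [hSS]
  -- the reduced exponents
  obtain ⟨u, hu⟩ : ∃ u : ℕ → ι → ℤ, u = fun j => β j + ((j : ℤ) - r) • q := ⟨_, rfl⟩
  have hul : ∀ j l, u j l = β j l + ((j : ℤ) - r) * q l := by intro j l; rw [hu]; simp
  have hβu : ∀ j ∈ J, ∀ l ∈ A, Φ2 (β j) l = u j l + r * q l := by
    intro j hj l hl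
    rw [hΦ2 _ l hl, hβz j hj, hul]; ring
  have hu1 : ∀ j ∈ J, j < r → ∀ l ∈ A, ((r : ℤ) - j) * e l ≤ s * u j l := by
    intro j hj hjr l hl
    have := hdiv j hj hjr l hl
    rw [hel] at this
    rw [hul]
    linarith
  have hu0 : ∀ j ∈ J, ∀ l ∈ A, 0 ≤ u j l := by
    intro j hj l hl
    rcases lt_or_ge j r with hjr | hjr
    · have h1 := hu1 j hj hjr l hl
      have h2 : 0 ≤ ((r : ℤ) - j) * e l := mul_nonneg (by omega) (he0 l)
      exact nonneg_of_mul_nonneg_right (le_trans h2 h1) hs0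
    · rw [hul]
      exact add_nonneg (hnn j hj l hl) (mul_nonneg (by omega) (hq0 l hl))
  have hV : ∀ j ∈ J, wt (insert z A') w2 (Φ2 (β j)) + Φ2 (β j) y1 * wt (insert z A') w2 κ =
      (w2 z * j + wt A' w (u j) + u j y1 * K) + (r * wt A' w q + r * q y1 * K) := by
    intro j hj
    rw [hwS, hΦ2' _ z hzA, hβz j hj, hβu j hj y1 hy1, ← hK]
    have : wt A' w (Φ2 (β j)) = wt A' w (u j + (r : ℤ) • q) :=
      wt_congr A' (fun _ _ => rfl) fun l hl => by rw [hβu j hj l (hA'A l hl)]; simp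
    rw [this, wt_add, wt_smul]
    push_cast
    ring
  refine principle (insert z A') y1 hy1S w2 hpos2 hInd J ⟨r, hrJ⟩ _ r ?_ κ (hK ▸ hK0.le) hκ2 ?_
  · intro j hj l hl
    rw [← hSS] at hl
    rw [r2.out _ hl]
    exact hout j hj l hl
  · intro j hj hmin _ j' hj'
    rw [hβu j hj y1 hy1, hβu j' hj' y1 hy1]
    have h0 := hu0 j' hj' y1 hy1
    suffices u j y1 < r by omega
    by_contra hcon
    push Not at hcon
    have hconR : (r : ℝ) ≤ u j y1 := by exact_mod_cast hcon
    have hKu : r * K ≤ u j y1 * K := mul_le_mul_of_nonneg_right hconR hK0.le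
    rcases lt_or_ge j r with hjr | hjr
    · have h1 := hmin j1 hj1
      rw [hV j hj, hV j1 hj1] at h1
      have hue : ∀ l, u j1 l = e l := by
        intro l; rw [hul, hel, hs]; ring
      have h2 : wt A' w (u j1) = wt A' w e := wt_congr A' (fun _ _ => rfl) fun l _ => hue l
      rw [h2, hue] at h1
      have h3 : ((r : ℝ) - j) * wt A' w e ≤ s * wt A' w (u j) := by
        have : 0 ≤ wt A' w (s • u j - ((r : ℤ) - j) • e) := wt_nonneg A' hw fun l hl => by
          have := hu1 j hj hjr l (hA'A l hl)
          simpa using this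
        rw [wt_sub, wt_smul, wt_smul] at this
        push_cast at this
        linarith
      have h4 : w2 z * j + wt A' w (u j) + r * K ≤ w2 z * j1 + wt A' w e + e y1 * K := by linarith
      have h5 := mul_le_mul_of_nonneg_left h4 hs0R.le
      have h6 : (s * w2 z - wt A' w e) * ((j : ℝ) - j1) + s * r * K ≤ s * e y1 * K := by
        have : (s : ℝ) * wt A' w e = ((r : ℝ) - j1) * wt A' w e := by rw [hsR]
        nlinarith
      have hsK : 0 < s * K := mul_pos hs0R hK0
      have hj1R : (j1 : ℝ) ≥ 0 := Nat.cast_nonneg _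
      rcases le_or_gt j1 j with hjj | hjj
      · have : (j1 : ℝ) ≤ j := by exact_mod_cast hjj
        have h7 : 0 ≤ (s * w2 z - wt A' w e) * ((j : ℝ) - j1) :=
          mul_nonneg hZpos.le (by linarith)
        have h8 : s * K * e y1 < s * K * r := mul_lt_mul_of_pos_left (by linarith) hsK
        linarith
      · have : (j : ℝ) < j1 := by exact_mod_cast hjj
        have h7 : (s * w2 z - wt A' w e) * ((j1 : ℝ) - j) ≤ s * K * ((j1 : ℝ) - j) :=
          mul_le_mul_of_nonneg_right (by rw [hK]; exact hκ1) (by linarith)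
        have h8 : s * K * (e y1) < s * K * (r - j1 + j) :=
          mul_lt_mul_of_pos_left (by
            have : (0 : ℝ) ≤ j := Nat.cast_nonneg _
            linarith) hsK
        linarith
    · have h1 := hmin r hrJ
      rw [hV j hj, hV r hrJ] at h1
      have hur : ∀ l ∈ A, u r l = 0 := by
        intro l hl; rw [hul, hβr l hl]; simp
      have h2 : wt A' w (u r) = 0 := Finset.sum_eq_zero fun l hl => by
        rw [hur l (hA'A l hl)]; simp
      rw [h2, hur y1 hy1] at h1
      have h3 : 0 ≤ wt A' w (u j) := wt_nonneg A' hw fun l hl => hu0 j hj l (hA'A l hl)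
      have h4 : w2 z * r ≤ w2 z * j :=
        mul_le_mul_of_nonneg_left (by exact_mod_cast hjr) (hpos2 z).le
      have h5 : 0 < r * K := mul_pos (by exact_mod_cast (by omega : 0 < r)) hK0
      simp at h1
      linarith

theorem comb (A : Finset ι) (z : ι) (hzA : z ∉ A) (w : ι → ℝ) (hw : ∀ l, 0 < w l)
    (hI : Indep A w) (hz : ∀ q, wt A w q ≠ w z) (J : Finset ℕ) (β : ℕ → ι → ℤ) (r : ℕ)
    (hβz : ∀ j ∈ J, β j z = j) (hnn : ∀ j ∈ J, ∀ l ∈ A, 0 ≤ β j l)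
    (hout : ∀ j ∈ J, ∀ l, l ∉ insert z A → β j l = 0)
    (hrJ : r ∈ J) (hβr : ∀ l ∈ A, β r l = 0)
    (hδ : ∃ j ∈ J, j < r ∧ wt A w (β j) ≤ ((r : ℝ) - j) * w z) :
    Good (insert z A) w J β r := by
  obtain ⟨j2, hj2, hj2r, hδ2⟩ := hδ
  have hpos : ∀ j : ℕ, j < r → (0 : ℝ) < r - j := fun j hj => by
    have : (j : ℝ) < r := by exact_mod_cast hj
    linarith
  obtain ⟨j1, hj1', hmin'⟩ := (J.filter (· < r)).exists_min_image
    (fun j => wt A w (β j) / ((r : ℝ) - j)) ⟨j2, by simp [hj2, hj2r]⟩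
  simp only [Finset.mem_filter] at hj1' hmin'
  obtain ⟨hj1, hj1r⟩ := hj1'
  have hδ : wt A w (β j1) ≤ ((r : ℝ) - j1) * w z := by
    have h1 := hmin' j2 ⟨hj2, hj2r⟩
    have h2 : wt A w (β j2) / ((r : ℝ) - j2) ≤ w z := by
      rw [div_le_iff₀ (hpos _ hj2r)]; linarith
    have := (div_le_iff₀ (hpos _ hj1r)).1 (h1.trans h2)
    linarith
  have hmin : ∀ j ∈ J, j < r →
      ((r : ℝ) - j) * wt A w (β j1) ≤ ((r : ℝ) - j1) * wt A w (β j) := by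
    intro j hj hjr
    have := (div_le_div_iff₀ (hpos _ hj1r) (hpos _ hjr)).1 (hmin' j ⟨hj, hjr⟩)
    linarith
  by_cases hA : ∃ q, wt A w (β j1) ≤ ((r : ℝ) - j1) * wt A w q ∧ wt A w q < w z
  · obtain ⟨q, hq1, hq2⟩ := hA
    have hb0 : ∀ j ∈ J, 0 ≤ wt A w (β j) := fun j hj => wt_nonneg A hw (hnn j hj)
    have hq0 : 0 ≤ wt A w q :=
      nonneg_of_mul_nonneg_right ((hb0 j1 hj1).trans hq1) (hpos _ hj1r)
    refine principle A z hzA w hw hI J ⟨r, hrJ⟩ β r hout q hq0 hq2 ?_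
    intro j hj h1 h2 j' hj'
    rw [hβz j hj, hβz j' hj']
    suffices j < r by omega
    by_contra hcon
    push Not at hcon
    have h3 := h1 j1 hj1
    have h4 := h2 j1 hj1
    rw [hβz j hj, hβz j1 hj1] at h3 h4
    have h5 : (r : ℝ) * wt A w q ≤ j * wt A w q :=
      mul_le_mul_of_nonneg_right (by exact_mod_cast hcon) hq0
    have h6 := hb0 j hj
    push_cast at h3 h4
    have := h4 (by linarith)
    omega
  · push Not at hA
    obtain ⟨w1, Φ1, r1, hΦ1⟩ := perron A w hw hI (J.filter (· < r))
      (fun j => ((r : ℤ) - j1) • β j - ((r : ℤ) - j) • β j1) (fun j hj => by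
        simp only [Finset.mem_filter] at hj
        rw [wt_sub, wt_smul, wt_smul]
        have := hmin j hj.1 hj.2
        push_cast
        linarith)
    refine Good.of_reach (r1.mono (Finset.subset_insert _ _)) ?_
    refine caseB A z hzA w1 (r1.pos hw) (r1.indep hI) ?_ J _ r ?_ ?_ ?_ hrJ ?_ j1 hj1 hj1r ?_ ?_ ?_
    · intro q
      obtain ⟨c, rfl⟩ := r1.surj q
      rw [r1.weight, r1.outw hzA]
      exact hz c
    · intro j hj
      rw [r1.out _ hzA]; exact hβz j hj
    · intro j hj
      exact r1.nonneg (hnn j hj)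
    · intro j hj l hl
      rw [r1.out _ (fun h => hl (Finset.mem_insert_of_mem h))]
      exact hout j hj l hl
    · exact r1.zero_of_zero hβr
    · rw [r1.weight, r1.outw hzA]; exact hδ
    · intro j hj hjr l hl
      have := hΦ1 j (by simp [hj, hjr]) l hl
      rw [map_sub, map_zsmul, map_zsmul] at this
      simpa using this
    · intro q
      obtain ⟨c, rfl⟩ := r1.surj q
      rw [r1.weight, r1.weight, r1.outw hzA]
      exact hA c

lemma Reach.nonneg_all {S : Finset ι} {w w' : ι → ℝ} {Φ : (ι → ℤ) →+ (ι → ℤ)}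
    (h : Reach S w w' Φ) {d : ι → ℤ} (hd : ∀ l, 0 ≤ d l) : ∀ l, 0 ≤ Φ d l := by
  intro l
  by_cases hl : l ∈ S
  · exact h.nonneg (fun l _ => hd l) l hl
  · rw [h.out _ hl]; exact hd l

end Perron


namespace Perron

set_option linter.unusedSectionVars false

open MvPolynomial

section Step

variable {ι : Type*} [DecidableEq ι] [Fintype ι] {k : Type*} [Field k]

/-- the substitution `X_i ↦ X_i X_j` -/
noncomputable def phi (k : Type*) [Field k] (i j : ι) : MvPolynomial ι k →ₐ[k] MvPolynomial ι k :=
  aeval (fun l => X l * (if l = i then X j else 1))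

/-- the exponent map of `phi` -/
noncomputable def sft (i j : ι) (β : ι →₀ ℕ) : ι →₀ ℕ := β + Finsupp.single j (β i)

lemma sft_inj (i j : ι) (hij : i ≠ j) : Function.Injective (sft i j) := by
  intro a b h
  have hi : a i = b i := by
    have := DFunLike.congr_fun h i
    simpa [sft, Finsupp.single_apply, hij.symm] using this
  unfold sft at h
  rw [hi] at h
  exact add_right_cancel h

lemma phi_monomial (i j : ι) (β : ι →₀ ℕ) (c : k) :
    phi k i j (monomial β c) = monomial (sft i j β) c := by
  unfold phi
  rw [aeval_monomial, Finsupp.prod_fintype _ _ (by simp)]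
  simp only [mul_pow, Finset.prod_mul_distrib]
  have h1 : ∏ l, (if l = i then (X j : MvPolynomial ι k) else 1) ^ β l = X j ^ β i := by
    rw [Finset.prod_eq_single i] <;> simp +contextual
  rw [h1]
  have h2 : (monomial (sft i j β) c : MvPolynomial ι k) = monomial β c * monomial (Finsupp.single j (β i)) 1 := by
    rw [monomial_mul]; simp [sft]
  rw [h2, monomial_eq (s := β), Finsupp.prod_fintype _ _ (by simp), X_pow_eq_monomial, algebraMap_eq, mul_assoc]

lemma mem_support_phi (i j : ι) (hij : i ≠ j) (F : MvPolynomial ι k) (γ : ι →₀ ℕ) :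
    γ ∈ (phi k i j F).support ↔ ∃ β ∈ F.support, γ = sft i j β := by
  have hF : phi k i j F = ∑ β ∈ F.support, monomial (sft i j β) (coeff β F) := by
    conv_lhs => rw [F.as_sum, map_sum]
    exact Finset.sum_congr rfl fun β _ => phi_monomial i j β _
  rw [mem_support_iff, hF, coeff_sum]
  simp only [coeff_monomial]
  constructor
  · intro h
    obtain ⟨β, hβ, h2⟩ := Finset.exists_ne_zero_of_sum_ne_zero h
    refine ⟨β, hβ, ?_⟩
    by_contra hne
    exact h2 (if_neg fun h => hne h.symm)
  · rintro ⟨β, hβ, rfl⟩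
    rw [Finset.sum_eq_single β]
    · simpa using hβ
    · intro b _ hb
      rw [if_neg]
      exact fun h => hb (sft_inj i j hij h)
    · intro h; exact absurd hβ h

lemma phi_X (i j l : ι) : phi k i j (X l) = X l * (if l = i then X j else 1) := by
  simp [phi]

lemma exQ (i j : ι) (hij : i ≠ j) (P : MvPolynomial ι k) :
    ∃ (D : ℕ) (Q : MvPolynomial ι k), phi k i j Q = X j ^ D * P := by
  have hj : phi k i j (X j) = X j := by rw [phi_X, if_neg hij.symm, mul_one]
  induction P using MvPolynomial.induction_on with
  | C a => exact ⟨0, C a, by simp [phi]⟩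
  | add p q hp hq =>
    obtain ⟨D1, Q1, h1⟩ := hp
    obtain ⟨D2, Q2, h2⟩ := hq
    refine ⟨D1 + D2, X j ^ D2 * Q1 + X j ^ D1 * Q2, ?_⟩
    rw [map_add, map_mul, map_mul, map_pow, map_pow, hj, h1, h2]
    ring
  | mul_X p l hp =>
    obtain ⟨D1, Q1, h1⟩ := hp
    by_cases hl : l = i
    · refine ⟨D1 + 1, Q1 * X l, ?_⟩
      rw [map_mul, h1, phi_X, if_pos hl]; ring
    · refine ⟨D1, Q1 * X l, ?_⟩
      rw [map_mul, h1, phi_X, if_neg hl]; ring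

end Step

/-- A coordinate chart `k[x]` over `T` along the valuation `v`. -/
structure Chart {ι : Type*} {k T L Ks : Type*} [Field k] [CommRing T] [Field L] [Algebra k L]
    [Algebra T L] [Field Ks] (π : T →+* Ks) (κ : k →+* Ks) (v : AddValuation Ks (WithTop ℝ))
    (fL : L) (w : ι → ℝ) (x : ι → L) (x'' : ι → Ks) (F : MvPolynomial ι k) : Prop where
  algInd : AlgebraicIndependent k x
  contains : ∀ t : T, ∃ P, aeval x P = algebraMap T L t ∧ eval₂Hom κ x'' P = π t
  rep : ∀ i, ∃ a b : T, π b ≠ 0 ∧ x i = algebraMap T L a / algebraMap T L b ∧ x'' i = π a / π b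
  hF : aeval x F = fL
  ker : ∀ P, eval₂Hom κ x'' P = 0 → ∃ N, F ∣ monomial N 1 * P
  ker0 : eval₂Hom κ x'' F = 0
  val : ∀ i, v (x'' i) = (w i : WithTop ℝ)
  pos : ∀ i, 0 < w i

section Chart

variable {ι : Type*} [DecidableEq ι] [Fintype ι] {k T L Ks : Type*} [Field k] [CommRing T]
    [Field L] [Algebra k L]
    [Algebra T L] [Field Ks] {π : T →+* Ks} {κ : k →+* Ks} {v : AddValuation Ks (WithTop ℝ)}
    {fL : L} {w : ι → ℝ} {x : ι → L} {x'' : ι → Ks} {F : MvPolynomial ι k}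

lemma Chart.ne0 (h : Chart π κ v fL w x x'' F) (i : ι) : x'' i ≠ 0 := by
  intro h0
  have := h.val i
  rw [h0, AddValuation.map_zero] at this
  exact WithTop.top_ne_coe this

lemma Chart.step (h : Chart π κ v fL w x x'' F) (i j : ι) (hij : i ≠ j) (hw : w j < w i) :
    ∃ x1 x1'', Chart π κ v fL (w - Pi.single i (w j)) x1 x1'' (phi k i j F) := by
  have hx : ∀ l, x l ≠ 0 := fun l => h.algInd.ne_zero l
  have hx2 := h.ne0
  refine ⟨fun l => x l / (if l = i then x j else 1), fun l => x'' l / (if l = i then x'' j else 1), ?_⟩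
  set x1 := fun l => x l / (if l = i then x j else 1) with hx1
  set y1 := fun l => x'' l / (if l = i then x'' j else 1) with hy1
  have e1 : ∀ P, aeval x1 (phi k i j P) = aeval x P := by
    intro P
    have : (aeval x1).comp (phi k i j) = (aeval x : MvPolynomial ι k →ₐ[k] L) := by
      apply algHom_ext
      intro l
      rw [AlgHom.comp_apply, phi_X]
      by_cases hl : l = i
      · subst hl
        simp [hx1, hij.symm, hx j]
      · simp [hx1, hl]
    exact DFunLike.congr_fun this P
  have e2 : ∀ P, eval₂Hom κ y1 (phi k i j P) = eval₂Hom κ x'' P := by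
    intro P
    have : (eval₂Hom κ y1).comp (phi k i j : MvPolynomial ι k →+* MvPolynomial ι k) = eval₂Hom κ x'' := by
      apply ringHom_ext
      · intro r
        simp [phi]
      intro l
      rw [RingHom.comp_apply, RingHom.coe_coe, phi_X]
      by_cases hl : l = i
      · subst hl
        simp [hy1, hij.symm, hx2 j]
      · simp [hy1, hl]
    exact DFunLike.congr_fun this P
  constructor
  · rw [algebraicIndependent_iff]
    intro p hp
    obtain ⟨D, Q, hQ⟩ := exQ i j hij p
    have h1 : aeval x Q = 0 := by rw [← e1, hQ, map_mul, hp, mul_zero]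
    rw [(algebraicIndependent_iff.1 h.algInd) Q h1, map_zero] at hQ
    rcases mul_eq_zero.1 hQ.symm with h2 | h2
    · exact absurd h2 (pow_ne_zero _ (X_ne_zero j))
    · exact h2
  · intro t
    obtain ⟨P, hP1, hP2⟩ := h.contains t
    exact ⟨phi k i j P, by rw [e1, hP1], by rw [e2, hP2]⟩
  · intro l
    by_cases hl : l = i
    · obtain ⟨a, b, hb, ha1, ha2⟩ := h.rep l
      obtain ⟨c, d, hd, hc1, hc2⟩ := h.rep j
      have hc : π c ≠ 0 := by
        intro h0
        apply hx2 j
        rw [hc2, h0, zero_div]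
      refine ⟨a * d, b * c, by rw [map_mul]; exact mul_ne_zero hb hc, ?_, ?_⟩
      · simp only [hx1, if_pos hl, ha1, hc1, map_mul]
        rw [div_div_div_eq]
      · simp only [hy1, if_pos hl, ha2, hc2, map_mul]
        rw [div_div_div_eq]
    · simpa [hx1, hy1, hl] using h.rep l
  · rw [e1, h.hF]
  · intro P hP
    obtain ⟨D, Q, hQ⟩ := exQ i j hij P
    have h1 : eval₂Hom κ x'' Q = 0 := by rw [← e2, hQ, map_mul, hP, mul_zero]
    obtain ⟨N, hN⟩ := h.ker Q h1
    refine ⟨sft i j N + Finsupp.single j D, ?_⟩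
    have := map_dvd (phi k i j) hN
    rw [map_mul, phi_monomial, hQ, X_pow_eq_monomial, ← mul_assoc, monomial_mul, one_mul] at this
    exact this
  · rw [e2, h.ker0]
  · intro l
    by_cases hl : l = i
    · subst hl
      simp only [hy1, if_true, Pi.sub_apply, Pi.single_eq_same]
      have h1 : v (x'' l / x'' j) + v (x'' j) = v (x'' l) := by
        rw [← AddValuation.map_mul, div_mul_cancel₀ _ (hx2 j)]
      rw [h.val, h.val] at h1
      have h2 : v (x'' l / x'' j) ≠ ⊤ := by
        intro h0; rw [h0] at h1; simp at h1
      obtain ⟨a, ha⟩ := WithTop.ne_top_iff_exists.1 h2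
      rw [← ha] at h1 ⊢
      norm_cast at h1 ⊢
      linarith
    · simpa [hy1, hl] using h.val l
  · intro l
    by_cases hl : l = i
    · subst hl; simpa using hw
    · simpa [hl] using h.pos l

lemma Chart.reach {S : Finset ι} {w' : ι → ℝ} {Φ : (ι → ℤ) →+ (ι → ℤ)}
    (h : Chart π κ v fL w x x'' F) (hr : Reach S w w' Φ) :
    ∃ x1 x1'' F1, Chart π κ v fL w' x1 x1'' F1 ∧
      ∀ γ : ι →₀ ℕ, γ ∈ F1.support ↔ ∃ β ∈ F.support, (fun l => (γ l : ℤ)) = Φ (fun l => (β l : ℤ)) := by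
  induction hr with
  | refl =>
    refine ⟨x, x'', F, h, fun γ => ⟨fun hγ => ⟨γ, hγ, rfl⟩, ?_⟩⟩
    rintro ⟨β, hβ, h1⟩
    have : γ = β := by
      ext l
      have := congr_fun h1 l
      simpa using this
    rwa [this]
  | @step w1 Φ1 i j hi hj hij hlt hr ih =>
    obtain ⟨x1, y1, F1, hc, hs⟩ := ih
    obtain ⟨x2, y2, hc2⟩ := hc.step i j hij hlt
    refine ⟨x2, y2, _, hc2, fun γ => ?_⟩
    rw [mem_support_phi i j hij]
    have key : ∀ β : ι →₀ ℕ, (fun l => (sft i j β l : ℤ)) = mv i j (fun l => (β l : ℤ)) := by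
      intro β
      ext l
      simp only [sft, mv, AddMonoidHom.coe_mk, ZeroHom.coe_mk, Pi.add_apply, Finsupp.add_apply, Nat.cast_add]
      by_cases hl : l = j
      · subst hl; simp
      · simp [hl]
    constructor
    · rintro ⟨β, hβ, rfl⟩
      obtain ⟨α, hα, hα2⟩ := (hs β).1 hβ
      refine ⟨α, hα, ?_⟩
      rw [AddMonoidHom.comp_apply, ← hα2, key]
    · rintro ⟨α, hα, hα2⟩
      have hnn := hr.nonneg_all (d := fun l => (α l : ℤ)) (fun l => Int.natCast_nonneg _)
      set β : ι →₀ ℕ := Finsupp.equivFunOnFinite.symm (fun l => Int.toNat (Φ1 (fun l => (α l : ℤ)) l)) with hβ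
      have hβ2 : (fun l => (β l : ℤ)) = Φ1 (fun l => (α l : ℤ)) := by
        ext l
        simp only [hβ, Finsupp.equivFunOnFinite_symm_apply_apply]
        exact Int.toNat_of_nonneg (hnn l)
      refine ⟨β, (hs β).2 ⟨α, hα, hβ2⟩, ?_⟩
      ext l
      have := congr_fun hα2 l
      rw [AddMonoidHom.comp_apply, ← hβ2, ← key] at this
      exact Int.ofNat_inj.1 this

end Chart

section Rename

variable {ι ι' : Type*} {k T L Ks : Type*} [Field k] [CommRing T]
    [Field L] [Algebra k L]
    [Algebra T L] [Field Ks] {π : T →+* Ks} {κ : k →+* Ks} {v : AddValuation Ks (WithTop ℝ)}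
    {fL : L} {w : ι → ℝ} {x : ι → L} {x'' : ι → Ks} {F : MvPolynomial ι k}

lemma Chart.rename (h : Chart π κ v fL w x x'' F) (e : ι ≃ ι') :
    Chart π κ v fL (w ∘ e.symm) (x ∘ e.symm) (x'' ∘ e.symm) (MvPolynomial.rename e F) := by
  have e1 : ∀ P : MvPolynomial ι k, aeval (x ∘ e.symm) (MvPolynomial.rename e P) = aeval x P := by
    intro P; rw [aeval_rename]; congr 2; ext; simp
  have e2 : ∀ P, eval₂Hom κ (x'' ∘ e.symm) (MvPolynomial.rename e P) = eval₂Hom κ x'' P := by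
    intro P; rw [coe_eval₂Hom, eval₂_rename]; congr 1; ext; simp
  have e3 : ∀ P : MvPolynomial ι' k, MvPolynomial.rename e (MvPolynomial.rename e.symm P) = P := by
    intro P; rw [rename_rename]; simp
  constructor
  · exact h.algInd.comp _ e.symm.injective
  · intro t
    obtain ⟨P, hP1, hP2⟩ := h.contains t
    exact ⟨MvPolynomial.rename e P, by rw [e1, hP1], by rw [e2, hP2]⟩
  · intro i; exact h.rep (e.symm i)
  · rw [e1, h.hF]
  · intro P hP
    rw [← e3 P, e2] at hP
    obtain ⟨N, hN⟩ := h.ker _ hP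
    have := map_dvd (MvPolynomial.rename e) hN
    rw [map_mul, e3, rename_monomial] at this
    exact ⟨_, this⟩
  · rw [e2, h.ker0]
  · intro i; exact h.val _
  · intro i; exact h.pos _

end Rename

end Perron


namespace Perron

open MvPolynomial

section Fin

variable {ι : Type*} {k : Type*} [Field k]

lemma X_dvd_of_support (l : ι) (g : MvPolynomial ι k) (h : ∀ γ ∈ g.support, γ l ≠ 0) : X l ∣ g := by
  rw [X_dvd_iff_modMonomial_eq_zero]
  ext γ
  by_cases hl : Finsupp.single l 1 ≤ γ
  · rw [coeff_modMonomial_of_le _ hl, coeff_zero]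
  · rw [coeff_modMonomial_of_not_le _ hl, coeff_zero]
    by_contra hne
    apply hl
    rw [Finsupp.single_le_iff]
    exact Nat.one_le_iff_ne_zero.2 (h γ (mem_support_iff.2 hne))

lemma exists_strict (F : MvPolynomial ι k) (hF : F ≠ 0) :
    ∃ (c : ι →₀ ℕ) (g : MvPolynomial ι k), F = monomial c 1 * g ∧ ∀ i, ¬ X i ∣ g := by
  induction hn : F.totalDegree using Nat.strong_induction_on generalizing F with
  | _ n ih =>
    by_cases h : ∃ i, X i ∣ F
    · obtain ⟨i, G, rfl⟩ := h
      have hG : G ≠ 0 := by rintro rfl; simp at hF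
      have hd : (X i * G).totalDegree = 1 + G.totalDegree := by
        rw [totalDegree_mul_of_isDomain (X_ne_zero i) hG, totalDegree_X]
      obtain ⟨c, g, hg, hg2⟩ := ih G.totalDegree (by omega) G hG rfl
      refine ⟨Finsupp.single i 1 + c, g, ?_, hg2⟩
      conv_lhs => rw [hg, ← mul_assoc, X, monomial_mul, one_mul]
    · push Not at h
      exact ⟨0, F, by simp, h⟩

lemma dvd_of_dvd_monomial_mul {g P : MvPolynomial ι k} (hg : ∀ i, ¬ X i ∣ g) {N : ι →₀ ℕ}
    (h : g ∣ monomial N 1 * P) : g ∣ P := by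
  obtain ⟨m, r, -, hr, hm⟩ := dvd_monomial_mul_iff_exists.1 h
  have : m = 0 := by
    ext i
    by_contra hi
    apply hg i
    rw [hm]
    exact dvd_mul_of_dvd_left (X_dvd_monomial.2 (Or.inr hi)) _
  subst this
  rw [hm]
  simpa using hr

lemma coeff_aeval_last [DecidableEq ι] [Fintype ι] (last : ι) (p : MvPolynomial ι k) (n : ℕ) :
    (aeval (fun i => if i = last then (Polynomial.X : Polynomial k) else 0) p).coeff n =
      coeff (Finsupp.single last n) p := by
  induction p using MvPolynomial.induction_on' with
  | add p q hp hq => simp only [map_add, Polynomial.coeff_add, hp, hq, coeff_add]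
  | monomial γ a =>
    rw [aeval_monomial, coeff_monomial, Finsupp.prod_fintype _ _ (by simp)]
    by_cases h : ∀ l, l ≠ last → γ l = 0
    · have hγ : γ = Finsupp.single last (γ last) := by
        ext l
        by_cases hl : l = last
        · subst hl; simp
        · simp [h l hl, Ne.symm hl]
      have : ∏ i, (if i = last then (Polynomial.X : Polynomial k) else 0) ^ γ i = Polynomial.X ^ γ last := by
        rw [Finset.prod_eq_single last] <;> simp +contextual [h]
      rw [this]
      simp only [Polynomial.algebraMap_eq, Polynomial.coeff_C_mul, Polynomial.coeff_X_pow]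
      have : (n = γ last) ↔ γ = Finsupp.single last n := by
        constructor
        · rintro rfl; exact hγ
        · intro h; rw [h]; simp
      simp [this]
    · push Not at h
      obtain ⟨l, hl, hl2⟩ := h
      have : ∏ i, (if i = last then (Polynomial.X : Polynomial k) else 0) ^ γ i = 0 :=
        Finset.prod_eq_zero (Finset.mem_univ l) (by rw [if_neg hl, zero_pow hl2])
      rw [this, if_neg]
      · simp
      · intro h; apply hl2; rw [h]; simp [Ne.symm hl]

end Fin

section Dom

variable {ι : Type*} {k Ks : Type*} [Field k] [Field Ks] {κ : k →+* Ks}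
  {v : AddValuation Ks (WithTop ℝ)} {y : ι → Ks}

lemma val_nonneg (hκ : ∀ c, 0 ≤ v (κ c)) (hy : ∀ i, 0 < v (y i)) (p : MvPolynomial ι k) :
    0 ≤ v (eval₂Hom κ y p) := by
  induction p using MvPolynomial.induction_on with
  | C a => simpa using hκ a
  | add p q hp hq => rw [map_add]; exact AddValuation.map_le_add v hp hq
  | mul_X p i hp =>
    rw [map_mul, AddValuation.map_mul, eval₂Hom_X']
    exact add_nonneg hp (hy i).le

lemma val_sub (hκ : ∀ c, 0 ≤ v (κ c)) (hy : ∀ i, 0 < v (y i)) (p : MvPolynomial ι k) :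
    0 < v (eval₂Hom κ y p - κ (coeff 0 p)) := by
  induction p using MvPolynomial.induction_on with
  | C a => simp
  | add p q hp hq =>
    rw [map_add, coeff_add, map_add, add_sub_add_comm]
    exact AddValuation.map_lt_add v hp hq
  | mul_X p i hp =>
    have : coeff 0 (p * X i) = 0 := by
      classical
      rw [coeff_mul_X']; simp
    rw [this, map_zero, sub_zero, map_mul, AddValuation.map_mul, eval₂Hom_X']
    exact (hy i).trans_le (le_add_of_nonneg_left (val_nonneg hκ hy p))

lemma val_kappa (hκ : ∀ c, 0 ≤ v (κ c)) (c : k) (hc : c ≠ 0) : v (κ c) = 0 := by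
  have h : v (κ c) + v (κ c⁻¹) = 0 := by
    rw [← AddValuation.map_mul, ← map_mul, mul_inv_cancel₀ hc, map_one, AddValuation.map_one]
  have h1 := hκ c
  have h2 := hκ c⁻¹
  refine le_antisymm ?_ h1
  calc v (κ c) ≤ v (κ c) + v (κ c⁻¹) := le_add_of_nonneg_right h2
    _ = 0 := h

lemma val_unit (hκ : ∀ c, 0 ≤ v (κ c)) (hy : ∀ i, 0 < v (y i)) (p : MvPolynomial ι k)
    (hp : coeff 0 p ≠ 0) : v (eval₂Hom κ y p) = 0 := by
  have h1 := val_sub hκ hy p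
  rw [← val_kappa hκ _ hp] at h1
  have := AddValuation.map_add_eq_of_lt_left v h1
  rw [add_sub_cancel] at this
  rw [this, val_kappa hκ _ hp]

lemma val_div_nonneg (a b : Ks) (ha : 0 ≤ v a) (hb : v b = 0) : 0 ≤ v (a / b) := by
  have hb0 : b ≠ 0 := by rintro rfl; simp at hb
  have : v (a / b) + v b = v a := by rw [← AddValuation.map_mul, div_mul_cancel₀ _ hb0]
  rw [hb, add_zero] at this
  rwa [this]

end Dom

section Finish

variable {ι : Type*} [DecidableEq ι] [Fintype ι] {k T L Ks : Type*} [Field k] [CommRing T]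
    [Field L] [Algebra k L]
    [Algebra T L] [Field Ks] {π : T →+* Ks} {κ : k →+* Ks} {v : AddValuation Ks (WithTop ℝ)}
    {fL : L} {w : ι → ℝ} {x : ι → L} {x'' : ι → Ks} {F : MvPolynomial ι k}

lemma Chart.finish (h : Chart π κ v fL w x x'' F) (last : ι) (r : ℕ)
    (βs : ι →₀ ℕ) (hβs : βs ∈ F.support)
    (hβ : ∀ β ∈ F.support, (∀ l, l ≠ last → βs l ≤ β l) ∧ βs last < r + β last) :
    ∃ (c : ι → ℕ) (g : MvPolynomial ι k), Irreducible g ∧ (∀ i, ¬ X i ∣ g) ∧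
      fL = (∏ i, x i ^ c i) * aeval x g ∧
      RingHom.ker (eval₂Hom κ x'') = Ideal.span {g} ∧
      aeval (fun i => if i = last then (Polynomial.X : Polynomial k) else 0) g ≠ 0 ∧
      (aeval (fun i => if i = last then (Polynomial.X : Polynomial k) else 0) g).natTrailingDegree < r := by
  have hF0 : F ≠ 0 := by rintro rfl; simp at hβs
  obtain ⟨c, g, hFg, hg⟩ := exists_strict F hF0
  have hg0 : g ≠ 0 := by rintro rfl; simp at hFg; exact hF0 hFg
  have hker : RingHom.ker (eval₂Hom κ x'') = Ideal.span {g} := by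
    ext P
    rw [RingHom.mem_ker, Ideal.mem_span_singleton]
    constructor
    · intro hP
      obtain ⟨N, hN⟩ := h.ker P hP
      exact dvd_of_dvd_monomial_mul hg ((Dvd.intro_left _ hFg.symm).trans hN)
    · rintro ⟨Q, rfl⟩
      have h0 := h.ker0
      rw [hFg, map_mul, mul_eq_zero] at h0
      rw [map_mul]
      rcases h0 with h0 | h0
      · exfalso
        rw [coe_eval₂Hom, eval₂_monomial, map_one, one_mul, Finsupp.prod_fintype _ _ (by simp), Finset.prod_eq_zero_iff] at h0
        obtain ⟨i, -, hi⟩ := h0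
        exact h.ne0 i (eq_zero_of_pow_eq_zero hi)
      · rw [h0, zero_mul]
  have hprime : Prime g := by
    rw [← Ideal.span_singleton_prime hg0, ← hker]
    exact RingHom.ker_isPrime _
  have hsupp : ∀ γ, γ ∈ g.support ↔ c + γ ∈ F.support := by
    intro γ
    rw [mem_support_iff, mem_support_iff, hFg, coeff_monomial_mul, one_mul]
  obtain ⟨d, hd⟩ : ∃ d, βs = c + d := by
    rw [mem_support_iff, hFg, coeff_monomial_mul'] at hβs
    by_cases hle : c ≤ βs
    · exact ⟨βs - c, (add_tsub_cancel_of_le hle).symm⟩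
    · rw [if_neg hle] at hβs; exact absurd rfl hβs
  have hdg : d ∈ g.support := by rw [hsupp, ← hd]; exact hβs
  have hdl : ∀ l, l ≠ last → d l = 0 := by
    intro l hl
    by_contra hne
    apply hg l
    apply X_dvd_of_support
    intro γ hγ
    have := (hβ _ ((hsupp γ).1 hγ)).1 l hl
    rw [hd] at this
    simp only [Finsupp.add_apply] at this
    omega
  have hdr : d last < r := by
    have h1 : ∃ γ ∈ g.support, γ last = 0 := by
      by_contra hcon
      push Not at hcon
      exact hg last (X_dvd_of_support _ _ hcon)
    obtain ⟨γ, hγ, hγ0⟩ := h1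
    have := (hβ _ ((hsupp γ).1 hγ)).2
    rw [hd] at this
    simp only [Finsupp.add_apply] at this
    omega
  have hds : d = Finsupp.single last (d last) := by
    ext l
    by_cases hl : l = last
    · subst hl; simp
    · simp [hdl l hl, Ne.symm hl]
  have hco : (aeval (fun i => if i = last then (Polynomial.X : Polynomial k) else 0) g).coeff (d last) ≠ 0 := by
    rw [coeff_aeval_last, ← hds]
    exact mem_support_iff.1 hdg
  refine ⟨c, g, hprime.irreducible, hg, ?_, hker, ?_, ?_⟩
  · rw [← h.hF, hFg, map_mul, aeval_monomial, map_one, one_mul, Finsupp.prod_fintype _ _ (by simp)]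
  · intro h0
    rw [h0] at hco
    simp at hco
  · exact (Polynomial.natTrailingDegree_le_of_ne_zero hco).trans_lt hdr

end Finish

end Perron


namespace Perron

open MvPolynomial

section Init

variable {σ : Type*} {k : Type*} [Field k] {Ks : Type*} [Field Ks]

lemma clear_den (y : σ → FractionRing (MvPolynomial σ k)) (hy : AlgebraicIndependent k y)
    (ψ : MvPolynomial σ k →ₐ[k] MvPolynomial σ k)
    (hψ : ∀ a, aeval y (ψ a) = algebraMap (MvPolynomial σ k) (FractionRing (MvPolynomial σ k)) a)
    (p : MvPolynomial σ k) : ∃ b a, b ≠ 0 ∧ ψ b * p = ψ a := by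
  obtain ⟨a, b, hb, hab⟩ := IsFractionRing.div_surjective (A := MvPolynomial σ k) (aeval y p)
  have hb0 : b ≠ 0 := nonZeroDivisors.ne_zero hb
  refine ⟨b, a, hb0, ?_⟩
  have hinj : Function.Injective (aeval y : MvPolynomial σ k →ₐ[k] _) := hy
  apply hinj
  rw [map_mul, hψ, hψ, ← hab, mul_div_cancel₀]
  simpa using hb0

lemma clear_den_poly (y : σ → FractionRing (MvPolynomial σ k)) (hy : AlgebraicIndependent k y)
    (ψ : MvPolynomial σ k →ₐ[k] MvPolynomial σ k)
    (hψ : ∀ a, aeval y (ψ a) = algebraMap (MvPolynomial σ k) (FractionRing (MvPolynomial σ k)) a)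
    (p : Polynomial (MvPolynomial σ k)) : ∃ (b : MvPolynomial σ k)
      (h : Polynomial (MvPolynomial σ k)), b ≠ 0 ∧ Polynomial.C (ψ b) * p = h.map (ψ : MvPolynomial σ k →+* MvPolynomial σ k) := by
  induction p using Polynomial.induction_on' with
  | add p q hp hq =>
    obtain ⟨b1, h1, hb1, e1⟩ := hp
    obtain ⟨b2, h2, hb2, e2⟩ := hq
    refine ⟨b1 * b2, Polynomial.C b2 * h1 + Polynomial.C b1 * h2, mul_ne_zero hb1 hb2, ?_⟩
    simp only [Polynomial.map_add, Polynomial.map_mul, ← e1, ← e2, Polynomial.map_C, map_mul, RingHom.coe_coe]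
    ring
  | monomial n a =>
    obtain ⟨b, a', hb, e⟩ := clear_den y hy ψ hψ a
    refine ⟨b, Polynomial.monomial n a', hb, ?_⟩
    rw [Polynomial.map_monomial, Polynomial.C_mul_monomial, e]
    rfl

lemma init_chart (f : Polynomial (MvPolynomial σ k)) (hfm : f.Monic)
    (π : Polynomial (MvPolynomial σ k) →+* Ks) (hker : RingHom.ker π = Ideal.span {f})
    (v : AddValuation Ks (WithTop ℝ))
    (j : FractionRing (MvPolynomial σ k) →+* Ks)
    (hj : ∀ a, j (algebraMap _ _ a) = π (Polynomial.C a))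
    (y : σ → FractionRing (MvPolynomial σ k)) (hy : AlgebraicIndependent k y)
    (ψ : MvPolynomial σ k →ₐ[k] MvPolynomial σ k)
    (hψ : ∀ a, aeval y (ψ a) = algebraMap (MvPolynomial σ k) (FractionRing (MvPolynomial σ k)) a)
    (w : Option σ → ℝ) (hw0 : ∀ i, 0 < w i) (hwz : v (π Polynomial.X) = (w none : WithTop ℝ))
    (hws : ∀ s, v (j (y s)) = (w (some s) : WithTop ℝ)) :
    ∃ (x : Option σ → FractionRing (Polynomial (MvPolynomial σ k))) (x'' : Option σ → Ks),
      Chart π (π.comp ((Polynomial.C).comp (MvPolynomial.C))) v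
        (algebraMap (Polynomial (MvPolynomial σ k)) (FractionRing (Polynomial (MvPolynomial σ k))) f) w x x''
        ((optionEquivLeft k σ).symm (f.map (ψ : MvPolynomial σ k →+* MvPolynomial σ k))) := by
  have hψinj : Function.Injective ψ := by
    intro a b hab
    have := congr_arg (aeval y) hab
    rw [hψ, hψ] at this
    exact IsFractionRing.injective (MvPolynomial σ k) (FractionRing (MvPolynomial σ k)) this
  have hinj : Function.Injective ((algebraMap (Polynomial (MvPolynomial σ k)) (FractionRing (Polynomial (MvPolynomial σ k)))).comp Polynomial.C) :=
    (IsFractionRing.injective (Polynomial (MvPolynomial σ k)) (FractionRing (Polynomial (MvPolynomial σ k)))).comp Polynomial.C_injective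
  obtain ⟨i, hi⟩ : ∃ i : FractionRing (MvPolynomial σ k) →+* FractionRing (Polynomial (MvPolynomial σ k)),
      ∀ a, i (algebraMap _ _ a) = algebraMap _ _ (Polynomial.C a) :=
    ⟨IsFractionRing.lift hinj, fun a => IsFractionRing.lift_algebraMap hinj a⟩
  let x : Option σ → FractionRing (Polynomial (MvPolynomial σ k)) :=
    fun o => o.elim (algebraMap (Polynomial (MvPolynomial σ k)) _ Polynomial.X) (fun s => i (y s))
  let x'' : Option σ → Ks := fun o => o.elim (π Polynomial.X) (fun s => j (y s))
  let κ := π.comp ((Polynomial.C).comp (MvPolynomial.C : k →+* MvPolynomial σ k))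
  let EL : Polynomial (MvPolynomial σ k) →+* FractionRing (Polynomial (MvPolynomial σ k)) :=
    Polynomial.eval₂RingHom (i.comp (aeval y : MvPolynomial σ k →ₐ[k] _).toRingHom) (x none)
  let EK : Polynomial (MvPolynomial σ k) →+* Ks :=
    Polynomial.eval₂RingHom (j.comp (aeval y : MvPolynomial σ k →ₐ[k] _).toRingHom) (x'' none)
  let O := optionEquivLeft k σ
  have ikc : ∀ c : k, algebraMap k (FractionRing (MvPolynomial σ k)) c = algebraMap (MvPolynomial σ k) _ (C c) := by
    intro c
    rw [IsScalarTower.algebraMap_apply k (MvPolynomial σ k)]; rfl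
  have iLc : ∀ c : k, algebraMap k (FractionRing (Polynomial (MvPolynomial σ k))) c = algebraMap (Polynomial (MvPolynomial σ k)) _ (Polynomial.C (C c)) := by
    intro c
    rw [IsScalarTower.algebraMap_apply k (Polynomial (MvPolynomial σ k))]; rfl
  have hEL : ∀ P, aeval x P = EL (O P) := by
    intro P
    have : (aeval x : MvPolynomial (Option σ) k →ₐ[k] _).toRingHom = EL.comp (O : MvPolynomial (Option σ) k →+* _) := by
      apply ringHom_ext
      · intro c
        simp [EL, O, ikc, iLc, hi]
      · intro o
        rcases o with _ | s <;> simp [EL, O, x]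
    exact DFunLike.congr_fun this P
  have hEK : ∀ P, eval₂Hom κ x'' P = EK (O P) := by
    intro P
    have : eval₂Hom κ x'' = EK.comp (O : MvPolynomial (Option σ) k →+* _) := by
      apply ringHom_ext
      · intro c
        simp [EK, O, ikc, hj, κ]
      · intro o
        rcases o with _ | s <;> simp [EK, O, x'']
    exact DFunLike.congr_fun this P
  have hELm : ∀ t : Polynomial (MvPolynomial σ k), EL (t.map (ψ : MvPolynomial σ k →+* MvPolynomial σ k)) = algebraMap _ _ t := by
    intro t
    have : EL.comp (Polynomial.mapRingHom (ψ : MvPolynomial σ k →+* MvPolynomial σ k)) = algebraMap _ _ := by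
      apply Polynomial.ringHom_ext
      · intro a
        simp [EL, hψ, hi]
      · simp [EL, x]
    exact DFunLike.congr_fun this t
  have hEKm : ∀ t : Polynomial (MvPolynomial σ k), EK (t.map (ψ : MvPolynomial σ k →+* MvPolynomial σ k)) = π t := by
    intro t
    have : EK.comp (Polynomial.mapRingHom (ψ : MvPolynomial σ k →+* MvPolynomial σ k)) = π := by
      apply Polynomial.ringHom_ext
      · intro a
        simp [EK, hψ, hj]
      · simp [EK, x'']
    exact DFunLike.congr_fun this t
  refine ⟨x, x'', ?_⟩
  have hψb : ∀ b : MvPolynomial σ k, b ≠ 0 → Polynomial.C (ψ b) ≠ 0 := by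
    intro b hb
    rw [Ne, Polynomial.C_eq_zero, map_eq_zero_iff _ hψinj]
    exact hb
  constructor
  · rw [algebraicIndependent_iff]
    intro P hP
    rw [hEL] at hP
    obtain ⟨b, h, hb, e⟩ := clear_den_poly y hy ψ hψ (O P)
    have h1 := congr_arg EL e
    rw [map_mul, hP, mul_zero, hELm] at h1
    have h2 : h = 0 := (map_eq_zero_iff _ (IsFractionRing.injective (Polynomial (MvPolynomial σ k)) (FractionRing (Polynomial (MvPolynomial σ k))))).1 h1.symm
    rw [h2, Polynomial.map_zero] at e
    have h3 := (mul_eq_zero.1 e).resolve_left (hψb b hb)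
    exact (map_eq_zero_iff _ O.injective).1 h3
  · intro t
    refine ⟨O.symm (t.map (ψ : MvPolynomial σ k →+* MvPolynomial σ k)), ?_, ?_⟩
    · rw [hEL, AlgEquiv.apply_symm_apply, hELm]
    · change eval₂Hom κ x'' _ = _
      rw [hEK, AlgEquiv.apply_symm_apply, hEKm]
  · rintro (_ | s)
    · exact ⟨Polynomial.X, 1, by simp, by simp [x], by simp [x'']⟩
    · obtain ⟨a, b, hb, hab⟩ := IsFractionRing.div_surjective (A := MvPolynomial σ k) (y s)
      have hb0 : b ≠ 0 := nonZeroDivisors.ne_zero hb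
      refine ⟨Polynomial.C a, Polynomial.C b, ?_, ?_, ?_⟩
      · rw [← hj]
        rw [map_ne_zero]
        simpa using hb0
      · simp only [x, Option.elim, ← hab, map_div₀, hi]
      · simp only [x'', Option.elim, ← hab, map_div₀, hj]
  · rw [hEL, AlgEquiv.apply_symm_apply, hELm]
  · intro P hP
    change eval₂Hom κ x'' _ = _ at hP
    rw [hEK] at hP
    obtain ⟨b, h, hb, e⟩ := clear_den_poly y hy ψ hψ (O P)
    have h1 := congr_arg EK e
    rw [map_mul, hP, mul_zero, hEKm] at h1
    have h2 : f ∣ h := by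
      rw [← Ideal.mem_span_singleton, ← hker, RingHom.mem_ker, ← h1]
    have h3 := Polynomial.map_dvd (ψ : MvPolynomial σ k →+* MvPolynomial σ k) h2
    rw [← e] at h3
    have hm := hfm.map (ψ : MvPolynomial σ k →+* MvPolynomial σ k)
    rw [← Polynomial.modByMonic_eq_zero_iff_dvd hm, ← Polynomial.smul_eq_C_mul, Polynomial.smul_modByMonic,
      Polynomial.smul_eq_C_mul, mul_eq_zero, or_iff_right (hψb b hb), Polynomial.modByMonic_eq_zero_iff_dvd hm] at h3
    have h4 := map_dvd O.symm h3
    rw [AlgEquiv.symm_apply_apply] at h4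
    exact ⟨0, by simpa using h4⟩
  · change eval₂Hom κ x'' _ = _
    rw [hEK, AlgEquiv.apply_symm_apply, hEKm, ← RingHom.mem_ker, hker]
    exact Ideal.mem_span_singleton_self f
  · rintro (_ | s)
    · exact hwz
    · exact hws s
  · exact hw0

end Init

end Perron


namespace Perron

open MvPolynomial

section Val
variable {Ks : Type*} [Field Ks] {v : AddValuation Ks (WithTop ℝ)}

lemma val_coe_mul {a b : Ks} {r s : ℝ} (ha : v a = (r : WithTop ℝ)) (hb : v b = (s : WithTop ℝ)) :
    v (a * b) = ((r + s : ℝ) : WithTop ℝ) := by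
  rw [AddValuation.map_mul, ha, hb]; rfl

lemma val_coe_pow {a : Ks} {r : ℝ} (ha : v a = (r : WithTop ℝ)) (n : ℕ) :
    v (a ^ n) = (((n : ℝ) * r : ℝ) : WithTop ℝ) := by
  induction n with
  | zero => simp
  | succ n ih =>
    rw [pow_succ, val_coe_mul ih ha]
    congr 1; push_cast; ring

lemma val_ne_zero {a : Ks} {r : ℝ} (ha : v a = (r : WithTop ℝ)) : a ≠ 0 := by
  rintro rfl; simp at ha

lemma exists_val {a : Ks} (ha : a ≠ 0) : ∃ r : ℝ, v a = (r : WithTop ℝ) := by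
  have : v a ≠ ⊤ := fun h => ha ((AddValuation.top_iff v).1 h)
  obtain ⟨r, hr⟩ := WithTop.ne_top_iff_exists.1 this
  exact ⟨r, hr.symm⟩

lemma val_coe_inv {a : Ks} {r : ℝ} (ha : v a = (r : WithTop ℝ)) :
    v a⁻¹ = ((-r : ℝ) : WithTop ℝ) := by
  obtain ⟨s, hs⟩ := exists_val (v := v) (inv_ne_zero (val_ne_zero ha))
  have := val_coe_mul ha hs
  rw [mul_inv_cancel₀ (val_ne_zero ha), AddValuation.map_one] at this
  rw [hs]
  norm_cast at this ⊢
  linarith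

lemma val_coe_zpow {a : Ks} {r : ℝ} (ha : v a = (r : WithTop ℝ)) (n : ℤ) :
    v (a ^ n) = (((n : ℝ) * r : ℝ) : WithTop ℝ) := by
  obtain ⟨n, rfl | rfl⟩ := n.eq_nat_or_neg
  · rw [zpow_natCast, val_coe_pow ha]; simp
  · rw [zpow_neg, zpow_natCast, val_coe_inv (val_coe_pow ha n)]; simp

lemma val_coe_prod {τ : Type*} (s : Finset τ) {a : τ → Ks} {r : τ → ℝ}
    (ha : ∀ i ∈ s, v (a i) = (r i : WithTop ℝ)) :
    v (∏ i ∈ s, a i) = ((∑ i ∈ s, r i : ℝ) : WithTop ℝ) := by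
  classical
  induction s using Finset.induction_on with
  | empty => simp
  | insert i s hi ih =>
    rw [Finset.prod_insert hi, Finset.sum_insert hi]
    exact val_coe_mul (ha i (by simp)) (ih fun l hl => ha l (by simp [hl]))

end Val

lemma prod_X_pow_eq {σ τ k : Type*} [Field k] (s : Finset τ) (e : τ → σ) (b : τ → ℕ) :
    ∏ i ∈ s, (X (e i) : MvPolynomial σ k) ^ b i = monomial (∑ i ∈ s, Finsupp.single (e i) (b i)) 1 := by
  classical
  induction s using Finset.induction_on with
  | empty => simp
  | insert i s hi ih =>
    rw [Finset.prod_insert hi, Finset.sum_insert hi, ih, X_pow_eq_monomial, monomial_mul, one_mul]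

lemma elu_apply {k : Type u} [Field k] {M : ℕ} (helu : ELU k M) {Ks : Type*} [Field Ks]
    (v : AddValuation Ks (WithTop ℝ))
    (j : FractionRing (MvPolynomial (Fin M) k) →+* Ks)
    (hkV : ∀ c : k, 0 ≤ v (j (algebraMap k _ c)))
    (hres : ∀ x : Ks, 0 ≤ v x → ∃ c : k, 0 < v (x - j (algebraMap k _ c)))
    (hcenter : ∀ i : Fin M, 0 < v (j (algebraMap (MvPolynomial (Fin M) k) _ (X i))))
    (g : MvPolynomial (Fin M) k) (hg : g ≠ 0) :
    ∃ (y : Fin M → FractionRing (MvPolynomial (Fin M) k)) (w : Fin M → ℝ)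
      (ψ : MvPolynomial (Fin M) k →ₐ[k] MvPolynomial (Fin M) k) (n : ℕ) (hn : n ≤ M)
      (B : Fin M →₀ ℕ) (gbar : MvPolynomial (Fin M) k),
      AlgebraicIndependent k y ∧
      (∀ s, v (j (y s)) = (w s : WithTop ℝ)) ∧ (∀ s, 0 < w s) ∧
      (∀ a, aeval y (ψ a) = algebraMap (MvPolynomial (Fin M) k) (FractionRing (MvPolynomial (Fin M) k)) a) ∧
      (∀ a : Fin n → ℤ, ∑ i, (a i : ℝ) * w (Fin.castLE hn i) = 0 → a = 0) ∧
      coeff 0 gbar ≠ 0 ∧ ψ g = monomial B 1 * gbar ∧ ∀ s : Fin M, n ≤ s.val → B s = 0 := by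
  let μ : ValuationSubring (FractionRing (MvPolynomial (Fin M) k)) :=
    { carrier := {x | 0 ≤ v (j x)}
      mul_mem' := by
        intro a b ha hb
        simp only [Set.mem_ofPred_eq, map_mul, AddValuation.map_mul] at *
        exact add_nonneg ha hb
      one_mem' := by simp
      add_mem' := by
        intro a b ha hb
        simp only [Set.mem_ofPred_eq, map_add] at *
        exact AddValuation.map_le_add v ha hb
      zero_mem' := by simp
      neg_mem' := by
        intro a ha
        simp only [Set.mem_ofPred_eq, map_neg, AddValuation.map_neg] at *
        exact ha
      mem_or_inv_mem' := by
        intro a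
        by_cases ha : a = 0
        · left; simp [ha]
        · obtain ⟨r, hr⟩ := exists_val (v := v) ((map_ne_zero j).2 ha)
          have hr2 := val_coe_inv hr
          rw [← map_inv₀] at hr2
          simp only [Set.mem_ofPred_eq]
          simp only [Subsemiring.mem_carrier, hr, hr2]
          rcases le_total 0 r with h | h
          · left; exact_mod_cast h
          · right
            have : 0 ≤ -r := by linarith
            exact_mod_cast this }
  have hμ : ∀ x, x ∈ μ ↔ 0 ≤ v (j x) := fun x => Iff.rfl
  have hmax : ∀ x, MemMaxSet (μ : Set _) x ↔ 0 < v (j x) := by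
    intro x
    by_cases hx : x = 0
    · subst hx
      simp [MemMaxSet, μ]
    · obtain ⟨r, hr⟩ := exists_val (v := v) ((map_ne_zero j).2 hx)
      have hr2 := val_coe_inv hr
      rw [← map_inv₀] at hr2
      unfold MemMaxSet
      rw [SetLike.mem_coe, SetLike.mem_coe, hμ, hμ, hr, hr2]
      norm_cast
      constructor
      · rintro ⟨h1, h2⟩
        by_contra h3
        exact h2 hx (by linarith)
      · intro h
        exact ⟨h.le, fun _ h2 => by linarith⟩
  have hev : ∀ a : MvPolynomial (Fin M) k, j (algebraMap _ _ a) =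
      eval₂Hom (j.comp (algebraMap k _)) (fun i => j (algebraMap (MvPolynomial (Fin M) k) _ (X i))) a := by
    intro a
    have : j.comp (algebraMap (MvPolynomial (Fin M) k) _) = 
      eval₂Hom (j.comp (algebraMap k _)) (fun i => j (algebraMap (MvPolynomial (Fin M) k) _ (X i))) := by
      apply ringHom_ext
      · intro c
        simp [IsScalarTower.algebraMap_apply k (MvPolynomial (Fin M) k) (FractionRing (MvPolynomial (Fin M) k))]
      · intro i; simp
    exact DFunLike.congr_fun this a
  obtain ⟨y, hy, hrange, -, -, hymax, n, hn, hind, -, b, gbar, hgbar, hgeq⟩ := helu μ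
    (fun c => (hμ _).2 (hkV c))
    (by
      intro x hx
      obtain ⟨c, hc⟩ := hres (j x) ((hμ x).1 hx)
      refine ⟨Polynomial.X - Polynomial.C c, Polynomial.X_sub_C_ne_zero c, ?_⟩
      rw [hmax]
      simpa using hc)
    (by
      intro a b hb
      rw [hμ, map_div₀, hev, hev]
      exact val_div_nonneg _ _ (val_nonneg hkV hcenter a) (val_unit hkV hcenter b hb))
    (fun i => (hmax _).2 (hcenter i)) g hg
  have hyne : ∀ s, j (y s) ≠ 0 := fun s => (map_ne_zero j).2 (hy.ne_zero s)
  choose w hw using fun s => exists_val (v := v) (hyne s)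
  have hw0 : ∀ s, 0 < w s := by
    intro s
    have := (hmax _).1 (hymax s)
    rw [hw] at this
    exact_mod_cast this
  have hadj : ∀ i : Fin M, ∃ P : MvPolynomial (Fin M) k, aeval y P = algebraMap (MvPolynomial (Fin M) k) (FractionRing (MvPolynomial (Fin M) k)) (X i) := by
    intro i
    have := hrange ⟨X i, rfl⟩
    rw [SetLike.mem_coe, Algebra.adjoin_range_eq_range_aeval] at this
    exact this
  choose P hP using hadj
  have hψ : ∀ a, aeval y (aeval P a : MvPolynomial (Fin M) k) = algebraMap (MvPolynomial (Fin M) k) (FractionRing (MvPolynomial (Fin M) k)) a := by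
    intro a
    have : (aeval y).comp (aeval P : MvPolynomial (Fin M) k →ₐ[k] MvPolynomial (Fin M) k) =
        IsScalarTower.toAlgHom k (MvPolynomial (Fin M) k) (FractionRing (MvPolynomial (Fin M) k)) := by
      apply algHom_ext
      intro i
      simp [hP]
    exact DFunLike.congr_fun this a
  refine ⟨y, w, aeval P, n, hn, ∑ i, Finsupp.single (Fin.castLE hn i) (b i), gbar, hy, hw, hw0, hψ, ?_, hgbar, ?_, ?_⟩
  · intro a ha
    apply hind
    have hv : v (j (∏ i, y (Fin.castLE hn i) ^ a i)) = ((0 : ℝ) : WithTop ℝ) := by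
      rw [map_prod, ← ha]
      apply val_coe_prod
      intro i _
      rw [map_zpow₀]
      exact val_coe_zpow (hw _) _
    have hv2 := val_coe_inv hv
    rw [← map_inv₀] at hv2
    have h1 : (∏ i, y (Fin.castLE hn i) ^ a i) ∈ μ := by rw [hμ, hv]; exact le_rfl
    have h2 : (∏ i, y (Fin.castLE hn i) ^ a i)⁻¹ ∈ μ := by rw [hμ, hv2, neg_zero]; exact le_rfl
    have h0 : (∏ i, y (Fin.castLE hn i) ^ a i) ≠ 0 := (map_ne_zero j).1 (val_ne_zero hv)
    rw [← ValuationSubring.valuation_le_one_iff] at h1 h2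
    have h3 : μ.valuation (∏ i, y (Fin.castLE hn i) ^ a i) = 1 := by
      refine le_antisymm h1 ?_
      rw [map_inv₀] at h2
      exact (inv_le_one₀ (zero_lt_iff.2 ((map_ne_zero _).2 h0))).1 h2
    rw [map_prod] at h3
    simpa only [map_zpow₀] using h3
  · have hinj : Function.Injective (aeval y : MvPolynomial (Fin M) k →ₐ[k] _) := hy
    apply hinj
    rw [hψ, hgeq, ← prod_X_pow_eq, map_mul, map_prod]
    simp
  · intro s hs
    rw [Finsupp.finsetSum_apply]
    apply Finset.sum_eq_zero
    intro i _
    rw [Finsupp.single_apply, if_neg]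
    rintro rfl
    have := i.isLt
    simp at hs
    omega

end Perron


namespace Perron

open MvPolynomial

theorem core {k : Type u} [Field k] {M : ℕ}
    (f : Polynomial (MvPolynomial (Fin M) k))
    (hfirr : Irreducible f) (hfmonic : f.Monic)
    {Ks : Type*} [Field Ks] (π : Polynomial (MvPolynomial (Fin M) k) →+* Ks)
    (hker : RingHom.ker π = Ideal.span {f})
    (v : AddValuation Ks (WithTop ℝ))
    (hkV : ∀ c : k, 0 ≤ v (π (Polynomial.C (MvPolynomial.C c))))
    (hres : ∀ x : Ks, 0 ≤ v x →
      ∃ c : k, 0 < v (x - π (Polynomial.C (MvPolynomial.C c))))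
    (hcenter : ∀ i : Fin M, 0 < v (π (Polynomial.C (MvPolynomial.X i))))
    (hcenterm : 0 < v (π Polynomial.X))
    (helu : ELU k M)
    (r : ℕ) (hrdef : r = (f.map (MvPolynomial.eval fun _ => (0 : k))).natTrailingDegree)
    (hr : 1 < r)
    (hnotin : ¬ ∃ y : Ks,
      y ∈ Subfield.closure (Set.range
        (π.comp (Polynomial.C : MvPolynomial (Fin M) k →+* _))) ∧
      y ≠ 0 ∧ v y = v (π Polynomial.X)) :
    ∃ (w : Option (Fin M) → ℝ) (x : Option (Fin M) → FractionRing (Polynomial (MvPolynomial (Fin M) k)))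
      (x'' : Option (Fin M) → Ks) (F : MvPolynomial (Option (Fin M)) k) (m0 : Option (Fin M))
      (βs : Option (Fin M) →₀ ℕ),
      Chart π (π.comp ((Polynomial.C).comp (MvPolynomial.C))) v
        (algebraMap (Polynomial (MvPolynomial (Fin M) k)) (FractionRing (Polynomial (MvPolynomial (Fin M) k))) f) w x x'' F ∧
      βs ∈ F.support ∧
      ∀ β ∈ F.support, (∀ l, l ≠ m0 → βs l ≤ β l) ∧ βs m0 < r + β m0 := by
  have hdvd : ∀ t, π t = 0 → f ∣ t := fun t ht => by
    rw [← Ideal.mem_span_singleton, ← hker]; exact ht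
  have hπf : π f = 0 := by
    rw [← RingHom.mem_ker, hker]; exact Ideal.mem_span_singleton_self f
  -- the base field embedding
  have hCinj : Function.Injective (π.comp (Polynomial.C : MvPolynomial (Fin M) k →+* _)) := by
    rw [injective_iff_map_eq_zero]
    intro a ha
    by_contra ha0
    have h1 := Polynomial.natDegree_le_of_dvd (hdvd _ ha) (by simpa using ha0)
    rw [Polynomial.natDegree_C, Nat.le_zero] at h1
    have := hfmonic.natDegree_eq_zero.1 h1
    exact hfirr.not_isUnit (this ▸ isUnit_one)
  obtain ⟨j, hj⟩ : ∃ j : FractionRing (MvPolynomial (Fin M) k) →+* Ks,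
      ∀ a, j (algebraMap _ _ a) = π (Polynomial.C a) :=
    ⟨IsFractionRing.lift hCinj, fun a => IsFractionRing.lift_algebraMap hCinj a⟩
  have jk : ∀ c : k, j (algebraMap k _ c) = π (Polynomial.C (MvPolynomial.C c)) := by
    intro c
    rw [IsScalarTower.algebraMap_apply k (MvPolynomial (Fin M) k), hj]; rfl
  obtain ⟨y, w0, ψ, n, hn, B, gbar, hy, hw, hw0, hψ, hind, hgbar, hgeq, hB⟩ :=
    elu_apply helu v j (fun c => by rw [jk]; exact hkV c)
      (fun x hx => by simpa only [jk] using hres x hx)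
      (fun i => by rw [hj]; exact hcenter i)
      (∏ l ∈ f.support, f.coeff l)
      (Finset.prod_ne_zero_iff.2 fun l hl => Polynomial.mem_support_iff.1 hl)
  -- factorization of coefficients
  have hfac : ∀ l, ∃ (α : Fin M →₀ ℕ) (q : MvPolynomial (Fin M) k), l ∈ f.support →
      (α ≤ B ∧ coeff 0 q ≠ 0 ∧ ψ (f.coeff l) = monomial α 1 * q) := by
    intro l
    by_cases hl : l ∈ f.support
    · have h1 : ψ (f.coeff l) ∣ monomial B 1 * gbar := by
        rw [← hgeq]
        exact map_dvd ψ (Finset.dvd_prod_of_mem _ hl)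
      obtain ⟨α, q, hα, ⟨t, hq⟩, he⟩ := dvd_monomial_mul_iff_exists.1 h1
      refine ⟨α, q, fun _ => ⟨hα, ?_, he⟩⟩
      intro h0
      apply hgbar
      rw [← constantCoeff_eq] at h0 ⊢
      rw [hq, map_mul, h0, zero_mul]
    · exact ⟨0, 0, fun h => absurd h hl⟩
  choose α q hαq using hfac
  -- value of z
  have hz0 : π Polynomial.X ≠ 0 := by
    intro h0
    have h1 := hdvd _ h0
    have h2 := (hfirr.dvd_irreducible_iff_associated Polynomial.irreducible_X).1 h1
    have h3 := Polynomial.eq_of_monic_of_associated hfmonic Polynomial.monic_X h2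
    rw [h3, Polynomial.map_X, Polynomial.natTrailingDegree_X] at hrdef
    omega
  obtain ⟨ζ, hζ⟩ := exists_val (v := v) hz0
  have hζ0 : 0 < ζ := by rw [hζ] at hcenterm; exact_mod_cast hcenterm
  let w : Option (Fin M) → ℝ := fun o => o.elim ζ w0
  have hwpos : ∀ l, 0 < w l := by
    rintro (_ | s)
    · exact hζ0
    · exact hw0 s
  obtain ⟨x, x'', hchart⟩ := init_chart f hfmonic π hker v j hj y hy ψ hψ w hwpos hζ hw
  set F := (optionEquivLeft k (Fin M)).symm (f.map (ψ : MvPolynomial (Fin M) k →+* MvPolynomial (Fin M) k)) with hF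
  have hcoeff : ∀ β, coeff β F = coeff β.some (ψ (f.coeff (β none))) := by
    intro β
    rw [← optionEquivLeft_coeff_some_coeff_none, hF, AlgEquiv.apply_symm_apply, Polynomial.coeff_map]
    rfl
  let bh : ℕ → (Option (Fin M) →₀ ℕ) := fun l => Finsupp.optionElim l (α l)
  have hbhF : ∀ l ∈ f.support, bh l ∈ F.support := by
    intro l hl
    obtain ⟨-, h2, h3⟩ := hαq l hl
    rw [mem_support_iff, hcoeff, Finsupp.some_optionElim, Finsupp.optionElim_apply_none, h3]
    have := coeff_monomial_mul 0 (α l) (1 : k) (q l)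
    rw [add_zero, one_mul] at this
    rwa [this]
  have hFbh : ∀ β ∈ F.support, β none ∈ f.support ∧ bh (β none) ≤ β := by
    intro β hβ
    rw [mem_support_iff, hcoeff] at hβ
    have hl : β none ∈ f.support := by
      rw [Polynomial.mem_support_iff]
      intro h0
      rw [h0, map_zero, coeff_zero] at hβ
      exact hβ rfl
    refine ⟨hl, ?_⟩
    obtain ⟨-, h2, h3⟩ := hαq _ hl
    rw [h3, coeff_monomial_mul'] at hβ
    have hle : α (β none) ≤ β.some := by
      by_contra hc
      rw [if_neg hc] at hβ
      exact hβ rfl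
    rintro (_ | s)
    · simp only [bh, Finsupp.optionElim_apply_none]; exact le_rfl
    · simp only [bh, Finsupp.optionElim_apply_some]; exact hle s
  -- values of the coefficients
  have hkV' : ∀ c : k, 0 ≤ v ((j.comp (algebraMap k _)) c) := fun c => by
    rw [RingHom.comp_apply, jk]; exact hkV c
  have hyv : ∀ s, 0 < v (j (y s)) := fun s => by rw [hw]; exact_mod_cast hw0 s
  have hjy : ∀ p : MvPolynomial (Fin M) k, j (aeval y p) = eval₂Hom (j.comp (algebraMap k _)) (fun s => j (y s)) p := by
    intro p
    rw [aeval_def, coe_eval₂Hom, hom_eval₂]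
  have hval : ∀ l ∈ f.support, v (π (Polynomial.C (f.coeff l))) = ((∑ s, (α l s : ℝ) * w0 s : ℝ) : WithTop ℝ) := by
    intro l hl
    obtain ⟨-, h2, h3⟩ := hαq l hl
    rw [← hj, ← hψ, h3, map_mul, map_mul, AddValuation.map_mul, hjy (q l), val_unit hkV' hyv _ h2, add_zero,
      aeval_monomial, map_one, one_mul, Finsupp.prod_fintype _ _ (by simp), map_prod]
    apply val_coe_prod
    intro s _
    rw [map_pow]
    exact val_coe_pow (hw s) _
  -- combinatorial input
  let e : Fin n → Option (Fin M) := fun i => some (Fin.castLE hn i)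
  have he : Function.Injective e := fun a b h => Fin.castLE_injective hn (Option.some_injective _ h)
  let A : Finset (Option (Fin M)) := Finset.univ.image e
  have hzA : none ∉ A := by simp [A, e]
  have hwt : ∀ c : Option (Fin M) → ℤ, wt A w c = ∑ i, w0 (Fin.castLE hn i) * (c (e i) : ℝ) := by
    intro c
    unfold wt
    rw [Finset.sum_image (fun a _ b _ h => he h)]
    rfl
  have hI : Indep A w := by
    intro c hc l hl
    rw [hwt] at hc
    have := hind (fun i => c (e i)) (by rw [← hc]; exact Finset.sum_congr rfl fun i _ => mul_comm _ _)
    obtain ⟨i, -, rfl⟩ := Finset.mem_image.1 hl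
    exact congr_fun this i
  have hjcl : ∀ t, j t ∈ Subfield.closure (Set.range
        (π.comp (Polynomial.C : MvPolynomial (Fin M) k →+* _))) := by
    intro t
    obtain ⟨a, b, hb, hab⟩ := IsFractionRing.div_surjective (A := MvPolynomial (Fin M) k) t
    rw [← hab, map_div₀, hj, hj]
    exact div_mem (Subfield.subset_closure ⟨a, rfl⟩) (Subfield.subset_closure ⟨b, rfl⟩)
  have hz : ∀ c, wt A w c ≠ w none := by
    intro c hc
    apply hnotin
    have hv : v (j (∏ i, y (Fin.castLE hn i) ^ c (e i))) = ((wt A w c : ℝ) : WithTop ℝ) := by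
      rw [map_prod, hwt]
      apply val_coe_prod
      intro i _
      rw [map_zpow₀, mul_comm]
      exact val_coe_zpow (hw _) _
    exact ⟨_, hjcl _, val_ne_zero hv, by rw [hv, hc, hζ]; rfl⟩
  let β : ℕ → Option (Fin M) → ℤ := fun l o => (bh l o : ℤ)
  have hαout : ∀ l ∈ f.support, ∀ s : Fin M, n ≤ s.val → α l s = 0 := by
    intro l hl s hs
    have := (hαq l hl).1 s
    rw [hB s hs] at this
    omega
  have hwtα : ∀ l ∈ f.support, wt A w (β l) = ∑ s, (α l s : ℝ) * w0 s := by
    intro l hl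
    rw [hwt]
    have h1 : ∑ s ∈ Finset.univ.image (Fin.castLE hn), (α l s : ℝ) * w0 s = ∑ s, (α l s : ℝ) * w0 s := by
      apply Finset.sum_subset (Finset.subset_univ _)
      intro s _ hs
      rw [hαout l hl s, Nat.cast_zero, zero_mul]
      by_contra hlt
      push Not at hlt
      exact hs (Finset.mem_image.2 ⟨⟨s.val, hlt⟩, Finset.mem_univ _, rfl⟩)
    rw [← h1, Finset.sum_image (fun a _ b _ h => Fin.castLE_injective hn h)]
    apply Finset.sum_congr rfl
    intro i _
    simp only [β, bh, e, Finsupp.optionElim_apply_some, Int.cast_natCast]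
    ring
  -- the index r
  have hev0 : (MvPolynomial.eval fun _ => (0 : k)) (f.coeff r) ≠ 0 := by
    have hm := hfmonic.map (MvPolynomial.eval (fun _ : Fin M => (0 : k)))
    have := Polynomial.trailingCoeff_nonzero_iff_nonzero.2 hm.ne_zero
    rw [Polynomial.trailingCoeff, ← hrdef, Polynomial.coeff_map] at this
    exact this
  have hrJ : r ∈ f.support := by
    rw [Polynomial.mem_support_iff]
    intro h0; rw [h0] at hev0; simp at hev0
  have hvr : v (π (Polynomial.C (f.coeff r))) = 0 := by
    have h1 : coeff 0 (f.coeff r) ≠ 0 := by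
      have h2 : (MvPolynomial.eval fun _ : Fin M => (0 : k)) = constantCoeff := eval_zero
      rw [h2, constantCoeff_eq] at hev0
      exact hev0
    have h3 : ∀ a : MvPolynomial (Fin M) k, π (Polynomial.C a) = eval₂Hom (π.comp (Polynomial.C.comp C)) (fun i => π (Polynomial.C (X i))) a := by
      intro a
      have : π.comp (Polynomial.C : MvPolynomial (Fin M) k →+* _) = eval₂Hom (π.comp (Polynomial.C.comp C)) (fun i => π (Polynomial.C (X i))) := by
        apply ringHom_ext
        · intro c; simp
        · intro i; simp
      exact DFunLike.congr_fun this a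
    rw [h3]
    exact val_unit hkV hcenter _ h1
  have hαr : ∀ s, α r s = 0 := by
    have h1 := hval r hrJ
    rw [hvr] at h1
    have h2 : ∑ s, (α r s : ℝ) * w0 s = 0 := by exact_mod_cast h1.symm
    rw [Finset.sum_eq_zero_iff_of_nonneg (fun s _ => mul_nonneg (Nat.cast_nonneg _) (hw0 s).le)] at h2
    intro s
    have h3 := h2 s (Finset.mem_univ s)
    rcases mul_eq_zero.1 h3 with h4 | h4
    · exact_mod_cast h4
    · exact absurd h4 (hw0 s).ne'
  have hδ : ∃ l ∈ f.support, l < r ∧ wt A w (β l) ≤ ((r : ℝ) - l) * w none := by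
    by_contra hcon
    push Not at hcon
    have hterm : ∀ l ∈ f.support, v (π (Polynomial.C (f.coeff l) * Polynomial.X ^ l)) =
        ((wt A w (β l) + (l : ℝ) * ζ : ℝ) : WithTop ℝ) := by
      intro l hl
      rw [map_mul, map_pow]
      refine val_coe_mul ?_ (val_coe_pow hζ l)
      rw [hwtα l hl]; exact hval l hl
    have hwr : wt A w (β r) = 0 := by
      rw [hwtα r hrJ]; simp [hαr]
    have hsum : π (Polynomial.C (f.coeff r) * Polynomial.X ^ r) +
        ∑ l ∈ f.support.erase r, π (Polynomial.C (f.coeff l) * Polynomial.X ^ l) = 0 := by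
      rw [Finset.add_sum_erase _ (fun l => π (Polynomial.C (f.coeff l) * Polynomial.X ^ l)) hrJ, ← map_sum, ← Polynomial.as_sum_support_C_mul_X_pow, hπf]
    have hlt : (((r : ℝ) * ζ : ℝ) : WithTop ℝ) < v (∑ l ∈ f.support.erase r, π (Polynomial.C (f.coeff l) * Polynomial.X ^ l)) := by
      apply AddValuation.map_lt_sum v WithTop.coe_ne_top
      intro l hl
      obtain ⟨hlr, hl⟩ := Finset.mem_erase.1 hl
      rw [hterm l hl, WithTop.coe_lt_coe]
      rcases lt_or_gt_of_ne hlr with h | h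
      · have h1 := hcon l hl h
        change ((r : ℝ) - l) * ζ < _ at h1
        linarith
      · have h1 : 0 ≤ wt A w (β l) := by
          rw [hwtα l hl]
          exact Finset.sum_nonneg fun s _ => mul_nonneg (Nat.cast_nonneg _) (hw0 s).le
        have h2 : (r : ℝ) < l := by exact_mod_cast h
        have := mul_lt_mul_of_pos_right h2 hζ0
        linarith
    have h4 := hterm r hrJ
    rw [hwr, zero_add, eq_neg_of_add_eq_zero_left hsum, AddValuation.map_neg] at h4
    rw [h4] at hlt
    exact lt_irrefl _ hlt
  obtain ⟨w', Φ, hreach, m0, j0, hj0, hgood⟩ := comb A none hzA w hwpos hI hz f.support β r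
    (fun l _ => by simp only [β, bh, Finsupp.optionElim_apply_none])
    (fun l _ o _ => Int.natCast_nonneg _)
    (by
      rintro l hl (_ | s) hs
      · simp at hs
      · simp only [β, bh, Finsupp.optionElim_apply_some]
        rw [hαout l hl s, Nat.cast_zero]
        by_contra hlt
        push Not at hlt
        apply hs
        apply Finset.mem_insert_of_mem
        exact Finset.mem_image.2 ⟨⟨s.val, hlt⟩, Finset.mem_univ _, rfl⟩)
    hrJ
    (by
      intro o ho
      obtain ⟨i, -, rfl⟩ := Finset.mem_image.1 ho
      simp only [β, bh, e, Finsupp.optionElim_apply_some, hαr, Nat.cast_zero])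
    hδ
  obtain ⟨x1, x1'', F1, hc1, hs1⟩ := hchart.reach hreach
  have hnn := hreach.nonneg_all (d := β j0) (fun l => Int.natCast_nonneg _)
  let βs : Option (Fin M) →₀ ℕ := Finsupp.equivFunOnFinite.symm (fun l => Int.toNat (Φ (β j0) l))
  have hβs : ∀ l, (βs l : ℤ) = Φ (β j0) l := by
    intro l
    simp only [βs, Finsupp.equivFunOnFinite_symm_apply_apply]
    exact Int.toNat_of_nonneg (hnn l)
  refine ⟨w', x1, x1'', F1, m0, βs, hc1, ?_, ?_⟩
  · exact (hs1 βs).2 ⟨bh j0, hbhF j0 hj0, funext hβs⟩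
  · intro γ hγ
    obtain ⟨b, hb, hγb⟩ := (hs1 γ).1 hγ
    obtain ⟨h1, h2⟩ := hFbh b hb
    have h3 : ∀ l, Φ (β (b none)) l ≤ γ l := by
      intro l
      have h4 := hreach.nonneg_all (d := (fun l => (b l : ℤ)) - β (b none)) (fun l => by
        simp only [Pi.sub_apply, β]
        have := h2 l
        omega) l
      rw [map_sub, Pi.sub_apply] at h4
      have h5 := congr_fun hγb l
      rw [h5]
      linarith
    obtain ⟨g1, g2⟩ := hgood _ h1
    constructor
    · intro l hl
      have := g1 l hl
      rw [← hβs] at this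
      have h6 := h3 l
      omega
    · have := g2
      rw [← hβs] at this
      have h6 := h3 m0
      omega

end Perron


/-- **Theorem 3** of Cutkosky–Mourtada, "Defect and Local Uniformization".

With notation as in the module docstring: assume embedded local uniformization holds in
dimension `m − 1` over `k`, that `r = ord f(0,…,0,x_m) > 1`, and that
`ν*(z) ∉ Φ_ν`.  Then there is a birational extension `T → T' = k[x₁',…,x_m']` along
`ν*` (with `x₁',…,x_m'` in the quotient field of `T`, algebraically independent over
`k`) such that `f = x₁'^{c₁} ⋯ x_m'^{c_m} f'` with `f'` (the strict transform of `f`)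
irreducible in `T'` and divisible by no `xᵢ'`, the ring `S' = T'/(f')` is a birational
extension of `S` with quotient field `K*` whose localization at the maximal ideal
generated by the images `xᵢ''` of the `xᵢ'` is dominated by `ν*`, and
`ord f'(0,…,0,x_m') < r`. -/
theorem reduction_of_multiplicity_of_value_not_in_base_group
    (k : Type u) [Field k] (m : ℕ) (hm : 2 ≤ m)
    (f : Polynomial (MvPolynomial (Fin (m - 1)) k))
    (hfirr : Irreducible f) (hfmonic : f.Monic)
    (Kstar : Type u) [Field Kstar]
    (π : Polynomial (MvPolynomial (Fin (m - 1)) k) →+* Kstar)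
    (hker : RingHom.ker π = Ideal.span {f})
    (hKfrac : ∀ x : Kstar, ∃ a b : Polynomial (MvPolynomial (Fin (m - 1)) k),
      π b ≠ 0 ∧ x = π a / π b)
    -- `K*` is separable over `K`, the quotient field of `k[x₁,…,x_{m−1}]` inside `K*`
    (hsep : Algebra.IsSeparable
      ↥(Subfield.closure (Set.range
        (π.comp (Polynomial.C : MvPolynomial (Fin (m - 1)) k →+* _)))) Kstar)
    -- the rank-one valuation `ν*`, with value group a subgroup of `ℝ`
    (v : AddValuation Kstar (WithTop ℝ))
    -- `k ⊆ V_{ν*}` and the residue field of `ν*` is `k`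
    (hkV : ∀ c : k, 0 ≤ v (π (Polynomial.C (MvPolynomial.C c))))
    (hres : ∀ x : Kstar, 0 ≤ v x →
      ∃ c : k, 0 < v (x - π (Polynomial.C (MvPolynomial.C c))))
    -- `S ⊆ V_{ν*}`, and the center of `ν*` on `S` is `(x₁,…,x_m)`
    (hSV : ∀ t : Polynomial (MvPolynomial (Fin (m - 1)) k), 0 ≤ v (π t))
    (hcenter : ∀ i : Fin (m - 1), 0 < v (π (Polynomial.C (MvPolynomial.X i))))
    (hcenterm : 0 < v (π Polynomial.X))
    -- (i) embedded local uniformization in dimension `m − 1` over `k`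
    (helu : ELU k (m - 1))
    -- (ii) `r = ord f(0,…,0,x_m) > 1`
    (hr : 1 < (f.map (MvPolynomial.eval fun _ => (0 : k))).natTrailingDegree)
    -- (iii) `ν*(z) ∉ Φ_ν`
    (hnotin : ¬ ∃ y : Kstar,
      y ∈ Subfield.closure (Set.range
        (π.comp (Polynomial.C : MvPolynomial (Fin (m - 1)) k →+* _))) ∧
      y ≠ 0 ∧ v y = v (π Polynomial.X)) :
    ∃ x' : Fin m → FractionRing (Polynomial (MvPolynomial (Fin (m - 1)) k)),
      AlgebraicIndependent k x' ∧
      -- `T ⊆ T' = k[x₁',…,x_m']`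
      Set.range (algebraMap (Polynomial (MvPolynomial (Fin (m - 1)) k))
          (FractionRing (Polynomial (MvPolynomial (Fin (m - 1)) k)))) ⊆
        (Algebra.adjoin k (Set.range x') :
          Set (FractionRing (Polynomial (MvPolynomial (Fin (m - 1)) k)))) ∧
      -- `T'` has the same quotient field as `T`
      (∀ w : FractionRing (Polynomial (MvPolynomial (Fin (m - 1)) k)),
        ∃ a ∈ Algebra.adjoin k (Set.range x'), ∃ b ∈ Algebra.adjoin k (Set.range x'),
          b ≠ 0 ∧ w = a / b) ∧
      ∃ (c : Fin m → ℕ) (g' : MvPolynomial (Fin m) k),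
        -- `f = x₁'^{c₁} ⋯ x_m'^{c_m} f'` with `f'` irreducible, divisible by no `xᵢ'`
        Irreducible g' ∧
        (∀ i : Fin m, ¬ MvPolynomial.X i ∣ g') ∧
        algebraMap (Polynomial (MvPolynomial (Fin (m - 1)) k))
            (FractionRing (Polynomial (MvPolynomial (Fin (m - 1)) k))) f =
          (∏ i : Fin m, x' i ^ c i) * MvPolynomial.aeval x' g' ∧
        -- the images `xᵢ''` of the `xᵢ'` in `K*`, and `S' = T'/(f')`
        ∃ x'' : Fin m → Kstar,
          (∀ i : Fin m, ∃ a b : Polynomial (MvPolynomial (Fin (m - 1)) k),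
            π b ≠ 0 ∧
            x' i = algebraMap _ (FractionRing (Polynomial (MvPolynomial (Fin (m - 1)) k))) a /
              algebraMap _ (FractionRing (Polynomial (MvPolynomial (Fin (m - 1)) k))) b ∧
            x'' i = π a / π b) ∧
          -- `S' = T'/(f')` as a subring of `K*`: the kernel of `T' → K*` is `(f')`
          RingHom.ker (MvPolynomial.eval₂Hom
            (π.comp ((Polynomial.C).comp (MvPolynomial.C))) x'') = Ideal.span {g'} ∧
          -- `S'` contains the image of `S`, and has quotient field `K*`
          Set.range π ⊆ Set.range (MvPolynomial.eval₂Hom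
            (π.comp ((Polynomial.C).comp (MvPolynomial.C))) x'') ∧
          (∀ w : Kstar, ∃ a b : MvPolynomial (Fin m) k,
            MvPolynomial.eval₂Hom (π.comp ((Polynomial.C).comp (MvPolynomial.C))) x'' b ≠ 0 ∧
            w = MvPolynomial.eval₂Hom (π.comp ((Polynomial.C).comp (MvPolynomial.C))) x'' a /
              MvPolynomial.eval₂Hom (π.comp ((Polynomial.C).comp (MvPolynomial.C))) x'' b) ∧
          -- `ν*` dominates the localization of `S'` at `(x₁'',…,x_m'')`
          (∀ a b : MvPolynomial (Fin m) k, MvPolynomial.coeff 0 b ≠ 0 →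
            0 ≤ v (MvPolynomial.eval₂Hom (π.comp ((Polynomial.C).comp (MvPolynomial.C))) x'' a /
              MvPolynomial.eval₂Hom (π.comp ((Polynomial.C).comp (MvPolynomial.C))) x'' b)) ∧
          (∀ i : Fin m, 0 < v (x'' i)) ∧
          -- `ord f'(0,…,0,x_m') < r`
          MvPolynomial.aeval
            (fun i : Fin m => if (i : ℕ) = m - 1 then (Polynomial.X : Polynomial k) else 0)
            g' ≠ 0 ∧
          (MvPolynomial.aeval
            (fun i : Fin m => if (i : ℕ) = m - 1 then (Polynomial.X : Polynomial k) else 0)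
            g').natTrailingDegree <
            (f.map (MvPolynomial.eval fun _ => (0 : k))).natTrailingDegree := by
  obtain ⟨w, x0, x0'', F0, m0, βs, hc0, hβs, hβ⟩ := Perron.core f hfirr hfmonic π hker v hkV hres
    hcenter hcenterm helu _ rfl hr hnotin
  -- transport to `Fin m` with `m0` in last position
  have hcard : Fintype.card (Option (Fin (m - 1))) = Fintype.card (Fin m) := by
    simp only [Fintype.card_option, Fintype.card_fin]; omega
  let last : Fin m := ⟨m - 1, by omega⟩
  let e0 : Option (Fin (m - 1)) ≃ Fin m := Fintype.equivOfCardEq hcard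
  let e : Option (Fin (m - 1)) ≃ Fin m := e0.trans (Equiv.swap (e0 m0) last)
  have hem : e m0 = last := by simp [e]
  have hc := hc0.rename e
  have hsupp : ∀ β, β ∈ (MvPolynomial.rename e F0).support ↔ ∃ γ ∈ F0.support, β = γ.mapDomain e := by
    intro β
    classical
    rw [MvPolynomial.support_rename_of_injective e.injective, Finset.mem_image]
    simp only [eq_comm]
  have hmd : ∀ (γ : Option (Fin (m - 1)) →₀ ℕ) l, γ.mapDomain e l = γ (e.symm l) := by
    intro γ l
    conv_lhs => rw [← e.apply_symm_apply l]
    rw [Finsupp.mapDomain_apply e.injective]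
  obtain ⟨c, g', hirr, hX, hfeq, hkerg, hne, hlt⟩ := hc.finish last _ (βs.mapDomain e)
    ((hsupp _).2 ⟨βs, hβs, rfl⟩) (by
      intro β hβm
      obtain ⟨γ, hγ, rfl⟩ := (hsupp _).1 hβm
      obtain ⟨h1, h2⟩ := hβ γ hγ
      have hl : e.symm last = m0 := by rw [← hem, Equiv.symm_apply_apply]
      constructor
      · intro l hl2
        rw [hmd, hmd]
        apply h1
        intro h3
        exact hl2 (by rw [← hem, ← h3, Equiv.apply_symm_apply])
      · rw [hmd, hmd, hl]
        exact h2)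
  have hfun : (fun i : Fin m => if (i : ℕ) = m - 1 then (Polynomial.X : Polynomial k) else 0) =
      fun i => if i = last then (Polynomial.X : Polynomial k) else 0 := by
    funext i
    simp only [last, Fin.ext_iff]
  have hrange : Set.range (algebraMap (Polynomial (MvPolynomial (Fin (m - 1)) k))
          (FractionRing (Polynomial (MvPolynomial (Fin (m - 1)) k)))) ⊆
        (Algebra.adjoin k (Set.range (x0 ∘ e.symm)) :
          Set (FractionRing (Polynomial (MvPolynomial (Fin (m - 1)) k)))) := by
    rintro _ ⟨t, rfl⟩
    obtain ⟨P, hP, -⟩ := hc.contains t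
    rw [SetLike.mem_coe, Algebra.adjoin_range_eq_range_aeval]
    exact ⟨P, hP⟩
  have hpos : ∀ i : Fin m, 0 < v ((x0'' ∘ e.symm) i) := by
    intro i
    rw [hc.val i]
    exact_mod_cast hc.pos i
  refine ⟨x0 ∘ e.symm, hc.algInd, hrange, ?_, c, g', hirr, hX, hfeq, x0'' ∘ e.symm, hc.rep, hkerg,
    ?_, ?_, ?_, hpos, ?_, ?_⟩
  · intro t
    obtain ⟨a, b, hb, hab⟩ :=
      IsFractionRing.div_surjective (A := Polynomial (MvPolynomial (Fin (m - 1)) k)) t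
    refine ⟨_, hrange ⟨a, rfl⟩, _, hrange ⟨b, rfl⟩, ?_, hab.symm⟩
    simpa using nonZeroDivisors.ne_zero hb
  · rintro _ ⟨t, rfl⟩
    obtain ⟨P, -, hP⟩ := hc.contains t
    exact ⟨P, hP⟩
  · intro t
    obtain ⟨a, b, hb, hab⟩ := hKfrac t
    obtain ⟨P, -, hP⟩ := hc.contains a
    obtain ⟨Q, -, hQ⟩ := hc.contains b
    exact ⟨P, Q, by rw [hQ]; exact hb, by rw [hP, hQ]; exact hab⟩
  · intro a b hb
    exact Perron.val_div_nonneg _ _ (Perron.val_nonneg hkV hpos a) (Perron.val_unit hkV hpos b hb)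
  · rw [hfun]; exact hne
  · rw [hfun]; exact hlt
end
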